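/- arXiv:2007.11792 — 8 statements merged into one kernel-verified Lean document; each statement's English description precedes it below -/
import Mathlib

section
/- Let σ : 𝕋 → ℝ be continuous and non-constant with 0 < σ_min := inf_{x∈𝕋} σ(x) < sup_{x∈𝕋} σ(x) =: σ_max < ∞, and let u, v be a real-valued classical solution of the Goldstein–Taylor system ∂ₜu + ∂ₓv = 0, ∂ₜv + ∂ₓu = −σ(x)v on 𝕋 × (0,∞) with initial data u₀, v₀. Set f₊ := (u+v)/2, f₋ := (u−v)/2, f∞ := (u₀)_avg/2, θ* := min(σ_min, 4/σ_max), and α* := σ_min(4 + 2√(4−σ_min²) − σ_min σ_max)/(4 + 2√(4−σ_min²) − σ_min²) if σ_min < 4/σ_max, α* := σ_max − √(σ_max² − 4) if σ_min ≥ 4/σ_max. Then for all t ≥ 0: √(‖f₊(·,t) − f∞‖² + ‖f₋(·,t) − f∞‖²) ≤ √((2+θ*)/(2−θ*)) · √(‖f₊(·,0) − f∞‖² + ‖f₋(·,0) − f∞‖²) · e^{−(α*/2)t}. -/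
open MeasureTheory Real

/-- Average of a (2π-periodic) function over one period. -/
noncomputable def havg (h : ℝ → ℝ) : ℝ := (1 / (2 * π)) * ∫ x in (0:ℝ)..(2 * π), h x

/-- Squared L²(𝕋) norm (normalized). -/
noncomputable def nsq (h : ℝ → ℝ) : ℝ := (1 / (2 * π)) * ∫ x in (0:ℝ)..(2 * π), (h x) ^ 2

/-- The anti-derivative ∂ₓ⁻¹ f with zero average. -/
noncomputable def antider (f : ℝ → ℝ) : ℝ → ℝ := fun x =>
  (∫ y in (0:ℝ)..x, f y) - havg (fun z => ∫ y in (0:ℝ)..z, f y)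

/-- The entropy functional E_θ(f,g). -/
noncomputable def entropyE (θ : ℝ) (f g : ℝ → ℝ) : ℝ :=
  nsq f + nsq g - (θ / (2 * π)) * ∫ x in (0:ℝ)..(2 * π), antider f x * g x

theorem sq_integral_le_sq_integral_deriv_of_integral_eq_zero {f f' : ℝ → ℝ}
    (hf : ∀ x, HasDerivAt f (f' x) x) (hf' : Continuous f') (hper : f 0 = f (2 * π))
    (hmean : ∫ x in (0:ℝ)..(2 * π), f x = 0) :
    ∫ x in (0:ℝ)..(2 * π), f x ^ 2 ≤ ∫ x in (0:ℝ)..(2 * π), f' x ^ 2 := by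
  have hpi : (0:ℝ) < 2 * π := by positivity
  have hfc : Continuous f := continuous_iff_continuousAt.2 fun x => (hf x).continuousAt
  have parseval (g : ℝ → ℝ) (hg : Continuous g) :=
    hasSum_sq_fourierCoeffOn (f := fun x => (g x : ℂ)) hpi
      ((memLp_two_iff_integrable_sq_norm (by fun_prop : Continuous fun x =>
        (g x : ℂ)).aestronglyMeasurable).2
          (by fun_prop : Continuous fun x => ‖(g x : ℂ)‖ ^ 2).integrableOn_Ioc)
  have key := hasSum_le (fun n : ℤ => ?_) (parseval f hfc) (parseval f' hf')
  · simp only [sub_zero, Complex.norm_real, norm_eq_abs, sq_abs, smul_eq_mul] at key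
    exact le_of_mul_le_mul_left key (inv_pos.2 hpi)
  · rcases eq_or_ne n 0 with rfl | hn
    · have : fourierCoeffOn hpi (fun x => (f x : ℂ)) 0 = 0 := by
        rw [fourierCoeffOn_eq_integral]
        simp [intervalIntegral.integral_ofReal, hmean]
      rw [this]
      simp
    · gcongr
      rw [fourierCoeffOn_of_hasDerivAt hpi hn (fun x _ => (hf x).ofReal_comp)
        ((by fun_prop : Continuous fun x => (f' x : ℂ)).intervalIntegrable _ _), hper]
      have h1 : (1:ℝ) ≤ |(n:ℝ)| := by exact_mod_cast Int.one_le_abs hn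
      have h2 : (0:ℝ) ≤ ‖fourierCoeffOn hpi (fun x => (f' x : ℂ)) n‖ := norm_nonneg _
      simp only [sub_self, mul_zero, zero_sub, norm_mul, norm_neg, norm_div, norm_one,
        Complex.norm_I, Complex.norm_intCast, Complex.norm_real, Complex.ofReal_zero, sub_zero,
        Complex.norm_ofNat, Complex.ofReal_mul, Complex.ofReal_ofNat, norm_eq_abs,
        abs_of_pos pi_pos]
      rw [← mul_assoc]
      refine mul_le_of_le_one_left h2 ?_
      rw [div_mul_eq_mul_div, div_le_one (by positivity)]
      nlinarith [pi_pos]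

theorem hasDerivAt_integral_of_continuousOn_deriv {F F' : ℝ → ℝ → ℝ}
    (hF : Continuous fun p : ℝ × ℝ => F p.1 p.2)
    (hF' : ContinuousOn (fun p : ℝ × ℝ => F' p.1 p.2) (Set.Ioi 0 ×ˢ Set.univ))
    (hder : ∀ t, 0 < t → ∀ x, HasDerivAt (fun s => F s x) (F' t x) t) (a b : ℝ) {t : ℝ}
    (ht : 0 < t) :
    HasDerivAt (fun s => ∫ x in a..b, F s x) (∫ x in a..b, F' t x) t := by
  have hcont (s : ℝ) : Continuous (F s) := hF.comp (by fun_prop : Continuous fun x : ℝ => (s, x))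
  have hcont' : Continuous (F' t) :=
    hF'.comp_continuous (by fun_prop : Continuous fun x : ℝ => (t, x)) (by simp [ht])
  obtain ⟨C, hC⟩ := ((isCompact_Icc (a := t / 2) (b := 2 * t)).prod
    (isCompact_uIcc (a := a) (b := b))).exists_bound_of_continuousOn
      (hF'.mono (Set.prod_mono (fun s hs => lt_of_lt_of_le (by positivity) hs.1)
        (Set.subset_univ _)))
  refine (intervalIntegral.hasDerivAt_integral_of_dominated_loc_of_deriv_le
    (s := Set.Icc (t / 2) (2 * t)) (bound := fun _ => C)
    (Icc_mem_nhds (by linarith) (by linarith))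
    (.of_forall fun s => (hcont s).aestronglyMeasurable) ((hcont t).intervalIntegrable _ _)
    hcont'.aestronglyMeasurable (.of_forall fun x hx s hs => ?_) (by simp)
    (.of_forall fun x _ s hs => hder s (lt_of_lt_of_le (by positivity) hs.1) x)).2
  exact hC (s, x) ⟨hs, Set.uIoc_subset_uIcc hx⟩

theorem quadratic_nonneg_of_mem_Icc {θ α M s : ℝ} (hα : α < θ) (hM : θ < M) (hθs : θ ≤ s)
    (hsM : s ≤ M) (hθ : 0 < θ) (hθ2 : θ < 2)
    (h : 4 * (M - θ) ^ 2 ≤ (4 - θ ^ 2) * (M - α) ^ 2) (X Y : ℝ) :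
    0 ≤ (θ - α) * X ^ 2 - θ * (s - α) * (X * Y) + (2 * s - θ - α) * Y ^ 2 := by
  have hdisc : 0 ≤ 4 * (θ - α) * (2 * s - θ - α) - θ ^ 2 * (s - α) ^ 2 := by
    have h4 : 0 ≤ (2 - θ) * (2 + θ) := mul_nonneg (sub_nonneg.2 hθ2.le) (by linarith [hθ])
    have h0 : 0 ≤ (4 - θ ^ 2) * (θ - α) ^ 2 := mul_nonneg (by linarith) (sq_nonneg _)
    have h1 : 0 ≤ θ ^ 2 * (s - θ) * (M - s) * (M - θ) :=
      mul_nonneg (mul_nonneg (mul_nonneg (sq_nonneg _) (by linarith)) (by linarith)) (by linarith)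
    have h2 := mul_nonneg (sub_nonneg.2 hsM) h0
    have h3 := mul_nonneg (sub_nonneg.2 hθs) (sub_nonneg.2 h)
    refine nonneg_of_mul_nonneg_right (a := M - θ) ?_ (by linarith)
    linear_combination h1 + h2 + h3
  refine nonneg_of_mul_nonneg_right (a := 4 * (θ - α)) ?_ (by linarith)
  linear_combination mul_nonneg hdisc (sq_nonneg Y) +
    sq_nonneg (2 * (θ - α) * X - θ * (s - α) * Y)

theorem integral_sub_average_mul {W b : ℝ → ℝ} (hW : Continuous W) (hb : Continuous b) :
    ∫ x in (0:ℝ)..(2 * π), (W x - (∫ y in (0:ℝ)..(2 * π), W y) / (2 * π)) * b x =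
      (∫ x in (0:ℝ)..(2 * π), W x * b x) -
        (∫ x in (0:ℝ)..(2 * π), W x) * (∫ x in (0:ℝ)..(2 * π), b x) / (2 * π) := by
  simp only [sub_mul]
  rw [intervalIntegral.integral_sub (Continuous.intervalIntegrable (by fun_prop) _ _)
    (Continuous.intervalIntegrable (by fun_prop) _ _), intervalIntegral.integral_const_mul]
  ring

theorem integral_sub_average_sq_le {W a : ℝ → ℝ} (hW : ∀ x, HasDerivAt W (a x) x)
    (ha : Continuous a) (hper : W 0 = W (2 * π)) :
    ∫ x in (0:ℝ)..(2 * π), (W x - (∫ y in (0:ℝ)..(2 * π), W y) / (2 * π)) ^ 2 ≤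
      ∫ x in (0:ℝ)..(2 * π), a x ^ 2 := by
  have hWc : Continuous W := continuous_iff_continuousAt.2 fun x => (hW x).continuousAt
  refine sq_integral_le_sq_integral_deriv_of_integral_eq_zero (fun x => (hW x).sub_const _) ha
    (by rw [hper]) ?_
  rw [intervalIntegral.integral_sub (hWc.intervalIntegrable _ _) (by simp)]
  simp only [intervalIntegral.integral_const, smul_eq_mul]
  field_simp
  ring

theorem abs_two_mul_covariance_le {W a b : ℝ → ℝ} (hW : ∀ x, HasDerivAt W (a x) x)
    (ha : Continuous a) (hb : Continuous b) (hper : W 0 = W (2 * π)) :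
    |2 * ((∫ x in (0:ℝ)..(2 * π), W x * b x) -
        (∫ x in (0:ℝ)..(2 * π), W x) * (∫ x in (0:ℝ)..(2 * π), b x) / (2 * π))| ≤
      (∫ x in (0:ℝ)..(2 * π), a x ^ 2) + ∫ x in (0:ℝ)..(2 * π), b x ^ 2 := by
  have hWc : Continuous W := continuous_iff_continuousAt.2 fun x => (hW x).continuousAt
  have hpoin := integral_sub_average_sq_le hW ha hper
  rw [← integral_sub_average_mul hWc hb]
  set m := (∫ y in (0:ℝ)..(2 * π), W y) / (2 * π)
  rw [← intervalIntegral.integral_const_mul]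
  refine (intervalIntegral.abs_integral_le_integral_abs (by positivity)).trans
    (le_trans ?_ (add_le_add_left hpoin _))
  rw [← intervalIntegral.integral_add (Continuous.intervalIntegrable (by fun_prop) _ _)
    (Continuous.intervalIntegrable (by fun_prop) _ _)]
  refine intervalIntegral.integral_mono_on (by positivity)
    (Continuous.intervalIntegrable (by fun_prop) _ _)
    (Continuous.intervalIntegrable (by fun_prop) _ _) fun x _ => ?_
  rw [abs_le]
  constructor <;> nlinarith [sq_nonneg (W x - m + b x), sq_nonneg (W x - m - b x)]

theorem integral_deriv_eq_zero_of_eq {f f' : ℝ → ℝ} (hf : ∀ x, HasDerivAt f (f' x) x)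
    (hf' : Continuous f') (hper : f 0 = f (2 * π)) : ∫ x in (0:ℝ)..(2 * π), f' x = 0 := by
  rw [intervalIntegral.integral_eq_sub_of_hasDerivAt (fun x _ => hf x)
    (hf'.intervalIntegrable _ _), hper, sub_self]

theorem entropy_dissipation {σ a b a' b' W : ℝ → ℝ} {θ α M : ℝ} (hσ : Continuous σ)
    (ha : ∀ x, HasDerivAt a (a' x) x) (ha' : Continuous a') (hap : a 0 = a (2 * π))
    (hb : ∀ x, HasDerivAt b (b' x) x) (hb' : Continuous b') (hbp : b 0 = b (2 * π))
    (hW : ∀ x, HasDerivAt W (a x) x) (hWp : W 0 = W (2 * π))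
    (hα : α < θ) (hM : θ < M) (hθσ : ∀ x, θ ≤ σ x) (hσM : ∀ x, σ x ≤ M) (hθ : 0 < θ)
    (hθ2 : θ < 2) (h : 4 * (M - θ) ^ 2 ≤ (4 - θ ^ 2) * (M - α) ^ 2) :
    (∫ x in (0:ℝ)..(2 * π), 2 * a x * -b' x) +
      (∫ x in (0:ℝ)..(2 * π), 2 * b x * (-a' x - σ x * b x)) -
      θ * ((∫ x in (0:ℝ)..(2 * π), ((b 0 - b x) * b x + W x * (-a' x - σ x * b x))) -
        ((∫ x in (0:ℝ)..(2 * π), (b 0 - b x)) * (∫ x in (0:ℝ)..(2 * π), b x) +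
          (∫ x in (0:ℝ)..(2 * π), W x) * ∫ x in (0:ℝ)..(2 * π), (-a' x - σ x * b x)) /
            (2 * π)) ≤
    -α * ((∫ x in (0:ℝ)..(2 * π), a x ^ 2) + (∫ x in (0:ℝ)..(2 * π), b x ^ 2) -
      θ * ((∫ x in (0:ℝ)..(2 * π), W x * b x) -
        (∫ x in (0:ℝ)..(2 * π), W x) * (∫ x in (0:ℝ)..(2 * π), b x) / (2 * π))) := by
  have hac : Continuous a := continuous_iff_continuousAt.2 fun x => (ha x).continuousAt
  have hbc : Continuous b := continuous_iff_continuousAt.2 fun x => (hb x).continuousAt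
  have hWc : Continuous W := continuous_iff_continuousAt.2 fun x => (hW x).continuousAt
  have ii {f : ℝ → ℝ} (hf : Continuous f) : IntervalIntegrable f volume 0 (2 * π) :=
    hf.intervalIntegrable _ _
  have hpoin := integral_sub_average_sq_le hW hac hWp
  have hcov := integral_sub_average_mul hWc hbc
  have hcovσ := integral_sub_average_mul hWc (b := fun x => σ x * b x) (by fun_prop)
  have hab : ∫ x in (0:ℝ)..(2 * π), (a' x * b x + a x * b' x) = 0 :=
    integral_deriv_eq_zero_of_eq (fun x => (ha x).mul (hb x)) (by fun_prop) (by simp [hap, hbp])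
  have hWa : ∫ x in (0:ℝ)..(2 * π), (a x * a x + W x * a' x) = 0 :=
    integral_deriv_eq_zero_of_eq (fun x => (hW x).mul (ha x)) (by fun_prop) (by simp [hap, hWp])
  have ha0 : ∫ x in (0:ℝ)..(2 * π), a' x = 0 := integral_deriv_eq_zero_of_eq ha ha' hap
  set m := (∫ y in (0:ℝ)..(2 * π), W y) / (2 * π) with hm
  have hquad : 0 ≤ ∫ x in (0:ℝ)..(2 * π), ((θ - α) * (W x - m) ^ 2 -
      θ * (σ x - α) * ((W x - m) * b x) + (2 * σ x - θ - α) * b x ^ 2) :=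
    intervalIntegral.integral_nonneg (by positivity) fun x _ =>
      quadratic_nonneg_of_mem_Icc hα hM (hθσ x) (hσM x) hθ hθ2 h _ _
  have equad : ∫ x in (0:ℝ)..(2 * π), ((θ - α) * (W x - m) ^ 2 -
      θ * (σ x - α) * ((W x - m) * b x) + (2 * σ x - θ - α) * b x ^ 2) =
      (θ - α) * (∫ x in (0:ℝ)..(2 * π), (W x - m) ^ 2)
      - θ * (∫ x in (0:ℝ)..(2 * π), (W x - m) * (σ x * b x))
      + θ * α * (∫ x in (0:ℝ)..(2 * π), (W x - m) * b x)
      + 2 * (∫ x in (0:ℝ)..(2 * π), σ x * b x ^ 2)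
      - (θ + α) * ∫ x in (0:ℝ)..(2 * π), b x ^ 2 := by
    simp only [← intervalIntegral.integral_const_mul]
    rw [← intervalIntegral.integral_sub (ii (by fun_prop)) (ii (by fun_prop)),
      ← intervalIntegral.integral_add (ii (by fun_prop)) (ii (by fun_prop)),
      ← intervalIntegral.integral_add (ii (by fun_prop)) (ii (by fun_prop)),
      ← intervalIntegral.integral_sub (ii (by fun_prop)) (ii (by fun_prop))]
    exact intervalIntegral.integral_congr fun x _ => by ring
  have e12 : (∫ x in (0:ℝ)..(2 * π), 2 * a x * -b' x) +
      (∫ x in (0:ℝ)..(2 * π), 2 * b x * (-a' x - σ x * b x)) =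
      -2 * (∫ x in (0:ℝ)..(2 * π), (a' x * b x + a x * b' x))
      - 2 * (∫ x in (0:ℝ)..(2 * π), σ x * b x ^ 2) := by
    simp only [← intervalIntegral.integral_const_mul]
    rw [← intervalIntegral.integral_sub (ii (by fun_prop)) (ii (by fun_prop)),
      ← intervalIntegral.integral_add (ii (by fun_prop)) (ii (by fun_prop))]
    exact intervalIntegral.integral_congr fun x _ => by ring
  have e3 : ∫ x in (0:ℝ)..(2 * π), ((b 0 - b x) * b x + W x * (-a' x - σ x * b x)) =
      b 0 * (∫ x in (0:ℝ)..(2 * π), b x) - (∫ x in (0:ℝ)..(2 * π), b x ^ 2)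
      - (∫ x in (0:ℝ)..(2 * π), (a x * a x + W x * a' x))
      + (∫ x in (0:ℝ)..(2 * π), a x ^ 2) - ∫ x in (0:ℝ)..(2 * π), W x * (σ x * b x) := by
    rw [← intervalIntegral.integral_const_mul,
      ← intervalIntegral.integral_sub (ii (by fun_prop)) (ii (by fun_prop)),
      ← intervalIntegral.integral_sub (ii (by fun_prop)) (ii (by fun_prop)),
      ← intervalIntegral.integral_add (ii (by fun_prop)) (ii (by fun_prop)),
      ← intervalIntegral.integral_sub (ii (by fun_prop)) (ii (by fun_prop))]
    exact intervalIntegral.integral_congr fun x _ => by ring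
  have e4 : ∫ x in (0:ℝ)..(2 * π), (b 0 - b x) = 2 * π * b 0 - ∫ x in (0:ℝ)..(2 * π), b x := by
    rw [intervalIntegral.integral_sub (ii (by fun_prop)) (ii (by fun_prop))]
    simp
  have e5 : ∫ x in (0:ℝ)..(2 * π), (-a' x - σ x * b x) =
      -(∫ x in (0:ℝ)..(2 * π), a' x) - ∫ x in (0:ℝ)..(2 * π), σ x * b x := by
    rw [intervalIntegral.integral_sub (ii (by fun_prop)) (ii (by fun_prop)),
      intervalIntegral.integral_neg]
  rw [e12, e3, e4, e5, hab, hWa, ha0]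
  rw [equad, hcov, hcovσ] at hquad
  have hP := mul_le_mul_of_nonneg_left hpoin (sub_pos.2 hα).le
  have hG : 0 ≤ θ * ((∫ x in (0:ℝ)..(2 * π), b x) ^ 2 / (2 * π)) := by positivity
  have hsplit : (2 * π * b 0 - ∫ x in (0:ℝ)..(2 * π), b x) * (∫ x in (0:ℝ)..(2 * π), b x) /
      (2 * π) = b 0 * (∫ x in (0:ℝ)..(2 * π), b x) -
        (∫ x in (0:ℝ)..(2 * π), b x) ^ 2 / (2 * π) := by
    field_simp
  rw [add_div, hsplit]
  linear_combination hquad + hP + hG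

theorem energy_decay_of_mean_zero {σ : ℝ → ℝ} {w v wx vx : ℝ → ℝ → ℝ} {θ α M : ℝ}
    (hσ : Continuous σ)
    (hw : Continuous fun p : ℝ × ℝ => w p.1 p.2) (hv : Continuous fun p : ℝ × ℝ => v p.1 p.2)
    (hwx : ContinuousOn (fun p : ℝ × ℝ => wx p.1 p.2) (Set.Ioi 0 ×ˢ Set.univ))
    (hvx : ContinuousOn (fun p : ℝ × ℝ => vx p.1 p.2) (Set.Ioi 0 ×ˢ Set.univ))
    (hwdx : ∀ t, 0 < t → ∀ x, HasDerivAt (w t) (wx t x) x)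
    (hvdx : ∀ t, 0 < t → ∀ x, HasDerivAt (v t) (vx t x) x)
    (hwdt : ∀ t, 0 < t → ∀ x, HasDerivAt (fun s => w s x) (-vx t x) t)
    (hvdt : ∀ t, 0 < t → ∀ x, HasDerivAt (fun s => v s x) (-wx t x - σ x * v t x) t)
    (hwp : ∀ t, w t 0 = w t (2 * π)) (hvp : ∀ t, v t 0 = v t (2 * π))
    (hmean : ∫ x in (0:ℝ)..(2 * π), w 0 x = 0)
    (hα : α < θ) (hM : θ < M) (hθσ : ∀ x, θ ≤ σ x) (hσM : ∀ x, σ x ≤ M) (hθ : 0 < θ)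
    (hθ2 : θ < 2) (h : 4 * (M - θ) ^ 2 ≤ (4 - θ ^ 2) * (M - α) ^ 2) {t : ℝ} (ht : 0 ≤ t) :
    (∫ x in (0:ℝ)..(2 * π), w t x ^ 2) + (∫ x in (0:ℝ)..(2 * π), v t x ^ 2) ≤
      (2 + θ) / (2 - θ) * ((∫ x in (0:ℝ)..(2 * π), w 0 x ^ 2) +
        ∫ x in (0:ℝ)..(2 * π), v 0 x ^ 2) * exp (-α * t) := by
  have slice {f : ℝ → ℝ → ℝ} (hf : Continuous fun p : ℝ × ℝ => f p.1 p.2) (s : ℝ) :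
      Continuous (f s) := hf.comp (by fun_prop : Continuous fun x : ℝ => (s, x))
  have sliceOn {f : ℝ → ℝ → ℝ}
      (hf : ContinuousOn (fun p : ℝ × ℝ => f p.1 p.2) (Set.Ioi 0 ×ˢ Set.univ)) {s : ℝ}
      (hs : 0 < s) : Continuous (f s) :=
    hf.comp_continuous (by fun_prop : Continuous fun x : ℝ => (s, x)) (by simp [hs])
  have intCont {f : ℝ → ℝ → ℝ} (hf : Continuous fun p : ℝ × ℝ => f p.1 p.2) :
      Continuous fun s => ∫ x in (0:ℝ)..(2 * π), f s x :=
    intervalIntegral.continuous_parametric_intervalIntegral_of_continuous' hf _ _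
  set W : ℝ → ℝ → ℝ := fun s x => ∫ y in (0:ℝ)..x, w s y with hWdef
  have hW : Continuous fun p : ℝ × ℝ => W p.1 p.2 :=
    intervalIntegral.continuous_parametric_primitive_of_continuous hw
  have hWdx (s x : ℝ) : HasDerivAt (W s) (w s x) x :=
    (slice hw s).integral_hasStrictDerivAt 0 x |>.hasDerivAt
  have hWdt (s : ℝ) (hs : 0 < s) (x : ℝ) :
      HasDerivAt (fun r => W r x) (v s 0 - v s x) s := by
    convert hasDerivAt_integral_of_continuousOn_deriv hw hvx.neg hwdt 0 x hs using 1
    rw [intervalIntegral.integral_neg, intervalIntegral.integral_eq_sub_of_hasDerivAt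
      (fun y _ => hvdx s hs y) ((sliceOn hvx hs).intervalIntegrable _ _)]
    ring
  have hWend (s : ℝ) (hs : 0 ≤ s) : W s (2 * π) = 0 := by
    rcases hs.eq_or_lt with rfl | hs
    · exact hmean
    · obtain ⟨r, hr, hslope⟩ := exists_hasDerivAt_eq_slope (fun r => W r (2 * π))
        (fun r => v r 0 - v r (2 * π)) hs
        (hW.comp (by fun_prop : Continuous fun r : ℝ => (r, 2 * π))).continuousOn
        fun r hr => hWdt r hr.1 _
      rw [hvp r, sub_self, eq_comm, div_eq_zero_iff, or_iff_left (by linarith)] at hslope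
      rw [sub_eq_zero.1 hslope]
      exact hmean
  have hWp (s : ℝ) (hs : 0 ≤ s) : W s 0 = W s (2 * π) := by
    rw [hWend s hs]
    exact intervalIntegral.integral_same
  set E : ℝ → ℝ := fun s =>
    (∫ x in (0:ℝ)..(2 * π), w s x ^ 2) + (∫ x in (0:ℝ)..(2 * π), v s x ^ 2) -
      θ * ((∫ x in (0:ℝ)..(2 * π), W s x * v s x) -
        (∫ x in (0:ℝ)..(2 * π), W s x) * (∫ x in (0:ℝ)..(2 * π), v s x) / (2 * π)) with hE
  have hEc : Continuous E := by
    have h1 := intCont (f := fun s x => w s x ^ 2) (by fun_prop)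
    have h2 := intCont (f := fun s x => v s x ^ 2) (by fun_prop)
    have h3 := intCont (f := fun s x => W s x * v s x) (by fun_prop)
    have h4 := intCont hW
    have h5 := intCont hv
    fun_prop
  have hEd (s : ℝ) (hs : 0 < s) : ∃ E', HasDerivAt E E' s ∧ E' ≤ -α * E s := by
    have hwO := hw.continuousOn (s := Set.Ioi (0:ℝ) ×ˢ (Set.univ : Set ℝ))
    have hvO := hv.continuousOn (s := Set.Ioi (0:ℝ) ×ˢ (Set.univ : Set ℝ))
    have hWO := hW.continuousOn (s := Set.Ioi (0:ℝ) ×ˢ (Set.univ : Set ℝ))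
    have hv0O : ContinuousOn (fun p : ℝ × ℝ => v p.1 0) (Set.Ioi (0:ℝ) ×ˢ Set.univ) :=
      (hv.comp (by fun_prop : Continuous fun p : ℝ × ℝ => (p.1, (0:ℝ)))).continuousOn
    have d1 := hasDerivAt_integral_of_continuousOn_deriv (F := fun r x => w r x ^ 2)
      (F' := fun r x => 2 * w r x * -vx r x) (by fun_prop) (by fun_prop)
      (fun r hr x => by simpa using (hwdt r hr x).fun_pow 2) 0 (2 * π) hs
    have d2 := hasDerivAt_integral_of_continuousOn_deriv (F := fun r x => v r x ^ 2)
      (F' := fun r x => 2 * v r x * (-wx r x - σ x * v r x)) (by fun_prop) (by fun_prop)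
      (fun r hr x => by simpa using (hvdt r hr x).fun_pow 2) 0 (2 * π) hs
    have d3 := hasDerivAt_integral_of_continuousOn_deriv (F := fun r x => W r x * v r x)
      (F' := fun r x => (v r 0 - v r x) * v r x + W r x * (-wx r x - σ x * v r x))
      (by fun_prop) (by fun_prop)
      (fun r hr x => (hWdt r hr x).mul (hvdt r hr x)) 0 (2 * π) hs
    have d4 := hasDerivAt_integral_of_continuousOn_deriv (F' := fun r x => v r 0 - v r x)
      hW (by fun_prop) hWdt 0 (2 * π) hs
    have d5 := hasDerivAt_integral_of_continuousOn_deriv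
      (F' := fun r x => -wx r x - σ x * v r x) hv (by fun_prop) hvdt 0 (2 * π) hs
    exact ⟨_, (d1.add d2).sub ((d3.sub ((d4.mul d5).div_const (2 * π))).const_mul θ),
      entropy_dissipation hσ (hwdx s hs) (sliceOn hwx hs) (hwp s) (hvdx s hs) (sliceOn hvx hs)
        (hvp s) (hWdx s) (hWp s hs.le) hα hM hθσ hσM hθ hθ2 h⟩
  have hdecay : E t ≤ E 0 * exp (-α * t) := by
    have hanti : AntitoneOn (fun s => E s * exp (α * s)) (Set.Ici 0) := by
      have hd (s : ℝ) (hs : 0 < s) : ∃ D ≤ 0, HasDerivAt (fun s => E s * exp (α * s)) D s := by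
        obtain ⟨E', hE', hle⟩ := hEd s hs
        refine ⟨_, ?_, hE'.mul (((hasDerivAt_id s).const_mul α).exp)⟩
        simp only [id, mul_one]
        nlinarith [exp_pos (α * s)]
      refine antitoneOn_of_deriv_nonpos (convex_Ici 0) (by fun_prop) ?_ ?_ <;>
        rw [interior_Ici] <;> intro s hs <;> obtain ⟨D, hD, hder⟩ := hd s hs
      · exact hder.differentiableAt.differentiableWithinAt
      · rwa [hder.deriv]
    have := hanti (Set.self_mem_Ici) (Set.mem_Ici.2 ht) ht
    simp only [mul_zero, exp_zero, mul_one] at this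
    rw [neg_mul, exp_neg, ← div_eq_mul_inv, le_div_iff₀ (exp_pos _)]
    exact this
  have cov (s : ℝ) (hs : 0 ≤ s) := abs_le.1
    (abs_two_mul_covariance_le (hWdx s) (slice hw s) (slice hv s) (hWp s hs))
  have hlow : (2 - θ) * ((∫ x in (0:ℝ)..(2 * π), w t x ^ 2) +
      ∫ x in (0:ℝ)..(2 * π), v t x ^ 2) ≤ 2 * E t := by
    simp only [hE]
    linear_combination θ * (cov t ht).2
  have hup : 2 * E 0 ≤ (2 + θ) * ((∫ x in (0:ℝ)..(2 * π), w 0 x ^ 2) +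
      ∫ x in (0:ℝ)..(2 * π), v 0 x ^ 2) := by
    simp only [hE]
    linear_combination θ * (cov 0 le_rfl).1
  rw [div_mul_eq_mul_div, div_mul_eq_mul_div, le_div_iff₀ (by linarith)]
  linear_combination hlow + 2 * hdecay + exp (-α * t) * hup

theorem hasFDerivAt_uncurry_of_contDiffOn {f : ℝ → ℝ → ℝ}
    (hf : ContDiffOn ℝ 1 (Function.uncurry f) (Set.Ici (0:ℝ) ×ˢ Set.univ))
    {t : ℝ} (ht : 0 < t) (x : ℝ) :
    HasFDerivAt (Function.uncurry f) (fderiv ℝ (Function.uncurry f) (t, x)) (t, x) :=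
  ((hf.contDiffAt (prod_mem_nhds (Ici_mem_nhds ht) Filter.univ_mem)).differentiableAt
    one_ne_zero).hasFDerivAt

theorem hasDerivAt_space_of_contDiffOn {f : ℝ → ℝ → ℝ}
    (hf : ContDiffOn ℝ 1 (Function.uncurry f) (Set.Ici (0:ℝ) ×ˢ Set.univ))
    {t : ℝ} (ht : 0 < t) (x : ℝ) :
    HasDerivAt (f t) (fderiv ℝ (Function.uncurry f) (t, x) (0, 1)) x :=
  (hasFDerivAt_uncurry_of_contDiffOn hf ht x).comp_hasDerivAt x
    ((hasDerivAt_const x t).prodMk (hasDerivAt_id x))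

theorem hasDerivAt_time_of_contDiffOn {f : ℝ → ℝ → ℝ}
    (hf : ContDiffOn ℝ 1 (Function.uncurry f) (Set.Ici (0:ℝ) ×ˢ Set.univ))
    {t : ℝ} (ht : 0 < t) (x : ℝ) :
    HasDerivAt (fun s => f s x) (deriv (fun s => f s x) t) t :=
  have h : HasDerivAt (fun s => f s x) (fderiv ℝ (Function.uncurry f) (t, x) (1, 0)) t :=
    (hasFDerivAt_uncurry_of_contDiffOn hf ht x).comp_hasDerivAt (f := fun s => (s, x)) t
      ((hasDerivAt_id t).prodMk (hasDerivAt_const t x))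
  h.differentiableAt.hasDerivAt

theorem continuousOn_deriv_space_of_contDiffOn {f : ℝ → ℝ → ℝ}
    (hf : ContDiffOn ℝ 1 (Function.uncurry f) (Set.Ici (0:ℝ) ×ˢ Set.univ)) :
    ContinuousOn (fun p : ℝ × ℝ => deriv (f p.1) p.2) (Set.Ioi 0 ×ˢ Set.univ) := by
  have hfO := hf.mono (Set.prod_mono_left Set.Ioi_subset_Ici_self)
  refine ((hfO.continuousOn_fderiv_of_isOpen (isOpen_Ioi.prod isOpen_univ) le_rfl).clm_apply
    (continuousOn_const (c := ((0:ℝ), (1:ℝ))))).congr fun p hp => ?_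
  exact (hasDerivAt_space_of_contDiffOn hf hp.1 p.2).deriv

theorem continuous_max_zero_of_contDiffOn {f : ℝ → ℝ → ℝ}
    (hf : ContDiffOn ℝ 1 (Function.uncurry f) (Set.Ici (0:ℝ) ×ˢ Set.univ)) :
    Continuous fun p : ℝ × ℝ => f (max p.1 0) p.2 :=
  hf.continuousOn.comp_continuous
    (by fun_prop : Continuous fun p : ℝ × ℝ => (max p.1 0, p.2)) (by simp)

theorem hasDerivAt_max_zero_time_of_contDiffOn {f : ℝ → ℝ → ℝ}
    (hf : ContDiffOn ℝ 1 (Function.uncurry f) (Set.Ici (0:ℝ) ×ˢ Set.univ))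
    {t : ℝ} (ht : 0 < t) (x : ℝ) :
    HasDerivAt (fun s => f (max s 0) x) (deriv (fun s => f s x) t) t := by
  refine (hasDerivAt_time_of_contDiffOn hf ht x).congr_of_eventuallyEq ?_
  filter_upwards [Ioi_mem_nhds ht] with s hs
  rw [max_eq_left (le_of_lt hs)]

theorem nsq_add_nsq_half {a b : ℝ → ℝ} (ha : Continuous a) (hb : Continuous b) (c : ℝ) :
    nsq (fun x => (a x + b x) / 2 - c / 2) + nsq (fun x => (a x - b x) / 2 - c / 2) =
      1 / (4 * π) * ((∫ x in (0:ℝ)..(2 * π), (a x - c) ^ 2) +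
        ∫ x in (0:ℝ)..(2 * π), b x ^ 2) := by
  have ii {f : ℝ → ℝ} (hf : Continuous f) : IntervalIntegrable f volume 0 (2 * π) :=
    hf.intervalIntegrable _ _
  unfold nsq
  rw [← mul_add, ← intervalIntegral.integral_add (ii (by fun_prop)) (ii (by fun_prop)),
    ← intervalIntegral.integral_add (ii (by fun_prop)) (ii (by fun_prop)),
    ← intervalIntegral.integral_const_mul, ← intervalIntegral.integral_const_mul]
  refine intervalIntegral.integral_congr fun x _ => ?_
  field_simp
  ring

theorem integral_sub_havg {f : ℝ → ℝ} (hf : Continuous f) :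
    ∫ x in (0:ℝ)..(2 * π), (f x - havg f) = 0 := by
  rw [intervalIntegral.integral_sub (hf.intervalIntegrable _ _) (by simp)]
  simp only [havg, intervalIntegral.integral_const, smul_eq_mul]
  field_simp
  ring

theorem decay_rate_conditions {m M : ℝ} (hm : 0 < m) (hmM : m < M) :
    let θ := min m (4 / M)
    let α := if m < 4 / M then
        m * (4 + 2 * √(4 - m ^ 2) - m * M) / (4 + 2 * √(4 - m ^ 2) - m ^ 2)
      else M - √(M ^ 2 - 4)
    α < θ ∧ θ < M ∧ 0 < θ ∧ θ < 2 ∧ 4 * (M - θ) ^ 2 ≤ (4 - θ ^ 2) * (M - α) ^ 2 := by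
  intro θ α
  have hM : 0 < M := hm.trans hmM
  have hθM : θ < M := (min_le_left _ _).trans_lt hmM
  have hθ0 : 0 < θ := lt_min hm (by positivity)
  by_cases hc : m < 4 / M
  · have hθ : θ = m := min_eq_left hc.le
    have hα : α = m * (4 + 2 * √(4 - m ^ 2) - m * M) / (4 + 2 * √(4 - m ^ 2) - m ^ 2) :=
      if_pos hc
    rw [lt_div_iff₀ hM] at hc
    have hm2 : m < 2 := by nlinarith
    have hpos : 0 < 4 - m ^ 2 := by nlinarith
    have hs := Real.sq_sqrt hpos.le
    have hs0 := Real.sqrt_pos.2 hpos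
    set s := √(4 - m ^ 2)
    have hs2 : s < 2 := by nlinarith
    have hden : 4 + 2 * s - m ^ 2 = s * (s + 2) := by linear_combination -hs
    have hMα : M - α = 2 * (M - m) / s := by
      rw [hα, hden]
      field_simp
      linear_combination M * hs
    have h1 : M - m < M - α := by
      rw [hMα, lt_div_iff₀ hs0]
      nlinarith
    refine ⟨by linarith, hθM, hθ0, by linarith, ?_⟩
    rw [hMα, hθ, ← hs]
    apply le_of_eq
    field_simp
    ring
  · have hθ : θ = 4 / M := min_eq_right (not_lt.1 hc)
    have hα : α = M - √(M ^ 2 - 4) := if_neg hc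
    rw [not_lt, div_le_iff₀ hM] at hc
    have hM2 : 2 < M := by nlinarith
    have hpos : 0 < M ^ 2 - 4 := by nlinarith
    have hs := Real.sq_sqrt hpos.le
    have hs0 := Real.sqrt_pos.2 hpos
    set s := √(M ^ 2 - 4)
    have hθM4 : θ * M = 4 := by rw [hθ]; field_simp
    have hθ2 : θ < 2 := by nlinarith
    refine ⟨?_, hθM, hθ0, hθ2, ?_⟩
    · rw [hα]
      nlinarith
    · rw [hα, sub_sub_cancel, hs]
      apply le_of_eq
      linear_combination (θ * M - 4) * hθM4

/-- Theorem 1.1 (b), L² decay of f± for non-constant relaxation σ(x). -/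
theorem gt_nonconstant_L2_decay
    (σ : ℝ → ℝ) (hσc : Continuous σ) (hσp : Function.Periodic σ (2 * π))
    (hmin : 0 < sInf (Set.range σ))
    (hminmax : sInf (Set.range σ) < sSup (Set.range σ))
    (u v : ℝ → ℝ → ℝ) (u₀ v₀ : ℝ → ℝ)
    (huC : ContDiffOn ℝ 1 (Function.uncurry u) (Set.Ici (0:ℝ) ×ˢ Set.univ))
    (hvC : ContDiffOn ℝ 1 (Function.uncurry v) (Set.Ici (0:ℝ) ×ˢ Set.univ))
    (hup : ∀ t, Function.Periodic (u t) (2 * π))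
    (hvp : ∀ t, Function.Periodic (v t) (2 * π))
    (hpde1 : ∀ t, 0 < t → ∀ x, deriv (fun s => u s x) t + deriv (fun y => v t y) x = 0)
    (hpde2 : ∀ t, 0 < t → ∀ x,
      deriv (fun s => v s x) t + deriv (fun y => u t y) x = -σ x * v t x)
    (hu0 : ∀ x, u 0 x = u₀ x) (hv0 : ∀ x, v 0 x = v₀ x) :
    ∀ t, 0 ≤ t →
      Real.sqrt (nsq (fun x => (u t x + v t x) / 2 - havg u₀ / 2) +
          nsq (fun x => (u t x - v t x) / 2 - havg u₀ / 2)) ≤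
        Real.sqrt ((2 + min (sInf (Set.range σ)) (4 / sSup (Set.range σ))) /
            (2 - min (sInf (Set.range σ)) (4 / sSup (Set.range σ)))) *
          Real.sqrt (nsq (fun x => (u₀ x + v₀ x) / 2 - havg u₀ / 2) +
            nsq (fun x => (u₀ x - v₀ x) / 2 - havg u₀ / 2)) *
          Real.exp (-((if sInf (Set.range σ) < 4 / sSup (Set.range σ) then
              sInf (Set.range σ) *
                  (4 + 2 * Real.sqrt (4 - sInf (Set.range σ) ^ 2) -
                    sInf (Set.range σ) * sSup (Set.range σ)) /
                (4 + 2 * Real.sqrt (4 - sInf (Set.range σ) ^ 2) - sInf (Set.range σ) ^ 2)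
            else sSup (Set.range σ) - Real.sqrt (sSup (Set.range σ) ^ 2 - 4)) / 2) * t) := by
  intro t ht
  obtain rfl : u 0 = u₀ := funext hu0
  obtain rfl : v 0 = v₀ := funext hv0
  have hcompact : IsCompact (Set.range σ) := hσp.compact_of_continuous (by positivity) hσc
  have hσmin (x : ℝ) : sInf (Set.range σ) ≤ σ x := csInf_le hcompact.bddBelow ⟨x, rfl⟩
  have hσmax (x : ℝ) : σ x ≤ sSup (Set.range σ) := le_csSup hcompact.bddAbove ⟨x, rfl⟩
  obtain ⟨hα, hM, hθ, hθ2, h⟩ := decay_rate_conditions hmin hminmax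
  have hθσ (x : ℝ) := (min_le_left _ (4 / sSup (Set.range σ))).trans (hσmin x)
  set θ := min (sInf (Set.range σ)) (4 / sSup (Set.range σ))
  generalize (if sInf (Set.range σ) < 4 / sSup (Set.range σ) then _ else _) = α at *
  generalize sSup (Set.range σ) = M at *
  have hu := continuous_max_zero_of_contDiffOn huC
  have hv := continuous_max_zero_of_contDiffOn hvC
  have slice {f : ℝ → ℝ → ℝ} (hf : Continuous fun p : ℝ × ℝ => f (max p.1 0) p.2) {s : ℝ}
      (hs : 0 ≤ s) : Continuous (f s) := by
    simpa [Function.comp_def, hs] using hf.comp (by fun_prop : Continuous fun x : ℝ => (s, x))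
  have hux (s : ℝ) (hs : 0 < s) (x : ℝ) : HasDerivAt (u s) (deriv (u s) x) x :=
    (hasDerivAt_space_of_contDiffOn huC hs x).differentiableAt.hasDerivAt
  have hvx (s : ℝ) (hs : 0 < s) (x : ℝ) : HasDerivAt (v s) (deriv (v s) x) x :=
    (hasDerivAt_space_of_contDiffOn hvC hs x).differentiableAt.hasDerivAt
  have key := energy_decay_of_mean_zero (w := fun s x => u (max s 0) x - havg (u 0))
    (v := fun s => v (max s 0)) (wx := fun s => deriv (u s)) (vx := fun s => deriv (v s)) hσc
    (hu.sub continuous_const) hv (continuousOn_deriv_space_of_contDiffOn huC)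
    (continuousOn_deriv_space_of_contDiffOn hvC)
    (fun s hs x => by
      simp only [max_eq_left hs.le]
      exact (hux s hs x).sub_const _)
    (fun s hs x => by simpa [hs.le] using hvx s hs x)
    (fun s hs x => by
      refine ((hasDerivAt_max_zero_time_of_contDiffOn huC hs x).sub_const _).congr_deriv ?_
      linear_combination hpde1 s hs x)
    (fun s hs x => by
      refine (hasDerivAt_max_zero_time_of_contDiffOn hvC hs x).congr_deriv ?_
      rw [max_eq_left hs.le]
      linear_combination hpde2 s hs x)
    (fun s => by simpa using (hup (max s 0) 0).symm)
    (fun s => by simpa using (hvp (max s 0) 0).symm)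
    (by simpa using integral_sub_havg (slice hu le_rfl)) hα hM hθσ hσmax hθ hθ2 h ht
  simp only [max_eq_left ht, max_self] at key
  rw [nsq_add_nsq_half (slice hu ht) (slice hv ht),
    nsq_add_nsq_half (slice hu le_rfl) (slice hv le_rfl)]
  have hexp : exp (-(α / 2) * t) = √(exp (-α * t)) := by
    rw [sqrt_eq_rpow, ← exp_mul]
    ring_nf
  rw [hexp, ← sqrt_mul (by apply div_nonneg <;> linarith), ← sqrt_mul' _ (exp_pos _).le]
  refine sqrt_le_sqrt ?_
  have := mul_le_mul_of_nonneg_left key (show 0 ≤ 1 / (4 * π) by positivity)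
  linear_combination this
end

section
/- Let σ > 2 be a real constant and set μ := σ/2 − √(σ²/4 − 1). For every k ∈ ℤ with k ≠ 0, define the complex 2×2 matrices C_k := [[0, ik],[ik, σ]] and P_k := [[1, −2i/(kσ)],[2i/(kσ), 1]]. Then P_k is Hermitian positive definite, and the Hermitian matrix C_k* P_k + P_k C_k − 2μ P_k is positive semidefinite, where C_k* denotes the conjugate transpose. -/
open Matrix
open scoped ComplexOrder

/-- The quadratic form of `!![a, -ic; ic, d]`, with the square completed. -/
lemma star_dotProduct_mulVec_eq_completed_square {a : ℝ} (ha : a ≠ 0) (c d : ℝ)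
    (x : Fin 2 → ℂ) :
    star x ⬝ᵥ ((!![(a : ℂ), -(Complex.I * c); Complex.I * c, (d : ℂ)] :
        Matrix (Fin 2) (Fin 2) ℂ) *ᵥ x) =
      (((Complex.normSq (a * x 0 - Complex.I * c * x 1) +
        (a * d - c ^ 2) * Complex.normSq (x 1)) / a : ℝ) : ℂ) := by
  have hac : (a : ℂ) ≠ 0 := by exact_mod_cast ha
  push_cast
  rw [eq_div_iff hac]
  simp only [Complex.normSq_eq_conj_mul_self, map_sub, map_mul, Complex.conj_I,
    Complex.conj_ofReal, Matrix.mulVec, dotProduct, Fin.sum_univ_two, Pi.star_apply,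
    Matrix.of_apply, Matrix.cons_val_zero, Matrix.cons_val_one, RCLike.star_def]
  linear_combination ((c : ℂ) ^ 2 * (starRingEnd ℂ) (x 1) * x 1) * Complex.I_sq

lemma isHermitian_fin_two_of_imaginary_offDiag (a c d : ℝ) :
    (!![(a : ℂ), -(Complex.I * c); Complex.I * c, (d : ℂ)] :
      Matrix (Fin 2) (Fin 2) ℂ).IsHermitian := by
  ext i j
  fin_cases i <;> fin_cases j <;> simp [Matrix.conjTranspose_apply]

lemma posSemidef_fin_two_of_imaginary_offDiag {a c d : ℝ} (ha : 0 < a) (h : c ^ 2 ≤ a * d) :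
    (!![(a : ℂ), -(Complex.I * c); Complex.I * c, (d : ℂ)] :
      Matrix (Fin 2) (Fin 2) ℂ).PosSemidef := by
  refine Matrix.posSemidef_iff_dotProduct_mulVec.2
    ⟨isHermitian_fin_two_of_imaginary_offDiag a c d, fun x => ?_⟩
  rw [star_dotProduct_mulVec_eq_completed_square ha.ne', Complex.zero_le_real]
  exact div_nonneg (add_nonneg (Complex.normSq_nonneg _)
    (mul_nonneg (sub_nonneg.2 h) (Complex.normSq_nonneg _))) ha.le

lemma posDef_fin_two_of_imaginary_offDiag {a c d : ℝ} (ha : 0 < a) (h : c ^ 2 < a * d) :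
    (!![(a : ℂ), -(Complex.I * c); Complex.I * c, (d : ℂ)] :
      Matrix (Fin 2) (Fin 2) ℂ).PosDef := by
  refine Matrix.posDef_iff_dotProduct_mulVec.2
    ⟨isHermitian_fin_two_of_imaginary_offDiag a c d, fun x hx => ?_⟩
  rw [star_dotProduct_mulVec_eq_completed_square ha.ne', Complex.zero_lt_real]
  refine div_pos ?_ ha
  by_cases h1 : x 1 = 0
  · have h0 : x 0 ≠ 0 := fun h0 => hx (by ext i; fin_cases i <;> simp [h0, h1])
    have : 0 < Complex.normSq (a * x 0) :=
      Complex.normSq_pos.2 (mul_ne_zero (by exact_mod_cast ha.ne') h0)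
    simpa [h1] using this
  · exact add_pos_of_nonneg_of_pos (Complex.normSq_nonneg _)
      (mul_pos (sub_pos.2 h) (Complex.normSq_pos.2 h1))

/-- Lemma 4.2: for σ > 2 and μ = σ/2 − √(σ²/4 − 1), the matrices
P_k^suff satisfy C_k* P_k + P_k C_k − 2μ P_k ≥ 0 for all modes k ≠ 0. -/
theorem gt_matrix_inequality_sigma_gt_two
    (σ : ℝ) (hσ : 2 < σ) (k : ℤ) (hk : k ≠ 0) :
    ((!![1, -2 * Complex.I / ((k : ℂ) * (σ : ℂ));
        2 * Complex.I / ((k : ℂ) * (σ : ℂ)), 1] : Matrix (Fin 2) (Fin 2) ℂ)).PosDef ∧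
    ((!![0, Complex.I * (k : ℂ); Complex.I * (k : ℂ), (σ : ℂ)] : Matrix (Fin 2) (Fin 2) ℂ)ᴴ *
        !![1, -2 * Complex.I / ((k : ℂ) * (σ : ℂ));
            2 * Complex.I / ((k : ℂ) * (σ : ℂ)), 1] +
      (!![1, -2 * Complex.I / ((k : ℂ) * (σ : ℂ));
          2 * Complex.I / ((k : ℂ) * (σ : ℂ)), 1] : Matrix (Fin 2) (Fin 2) ℂ) *
        !![0, Complex.I * (k : ℂ); Complex.I * (k : ℂ), (σ : ℂ)] -
      (((2 * (σ / 2 - Real.sqrt (σ ^ 2 / 4 - 1)) : ℝ) : ℂ)) •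
        !![1, -2 * Complex.I / ((k : ℂ) * (σ : ℂ));
            2 * Complex.I / ((k : ℂ) * (σ : ℂ)), 1]).PosSemidef := by
  have hσ0 : 0 < σ := by linarith
  have hkR : (k : ℝ) ≠ 0 := by exact_mod_cast hk
  have hkC : (k : ℂ) ≠ 0 := by exact_mod_cast hk
  have hσC : (σ : ℂ) ≠ 0 := by exact_mod_cast hσ0.ne'
  have hk1 : (1 : ℝ) ≤ (k : ℝ) ^ 2 := by
    exact_mod_cast (one_le_sq_iff_one_le_abs k).2 (Int.one_le_abs hk)
  have hb : (2 / (k * σ) : ℝ) ^ 2 ≤ 4 / σ ^ 2 := by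
    rw [div_pow, mul_pow, div_le_div_iff₀ (by positivity) (by positivity)]
    nlinarith [mul_le_mul_of_nonneg_right hk1 (sq_nonneg σ)]
  constructor
  · have hc : (2 / (k * σ) : ℝ) ^ 2 < 1 * 1 := by
      refine hb.trans_lt ?_
      rw [div_lt_iff₀ (by positivity)]
      nlinarith
    convert posDef_fin_two_of_imaginary_offDiag one_pos hc using 1
    ext i j
    fin_cases i <;> fin_cases j <;> simp <;> ring
  · obtain ⟨r, hr⟩ : ∃ r, r = Real.sqrt (σ ^ 2 / 4 - 1) := ⟨_, rfl⟩
    rw [← hr]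
    have hpos : 0 < σ ^ 2 / 4 - 1 := by nlinarith
    have hr0 : 0 < r := hr ▸ Real.sqrt_pos.2 hpos
    have hr2 : r ^ 2 = σ ^ 2 / 4 - 1 := hr ▸ Real.sq_sqrt hpos.le
    have hrσ : 2 * r < σ := by nlinarith
    have ha : 0 < 4 / σ - σ + 2 * r := by
      have : 4 / σ - σ + 2 * r = 2 * r * (σ - 2 * r) / σ := by
        field_simp
        linear_combination 4 * hr2
      rw [this]
      have := sub_pos.2 hrσ
      positivity
    have hdet : (2 / (k * σ) * (2 * r)) ^ 2 ≤
        (4 / σ - σ + 2 * r) * (σ - 4 / σ + 2 * r) := by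
      have : (4 / σ - σ + 2 * r) * (σ - 4 / σ + 2 * r) = 4 / σ ^ 2 * (2 * r) ^ 2 := by
        field_simp
        linear_combination (4 * σ ^ 2 - 16) * hr2
      rw [this, mul_pow]
      gcongr
    convert posSemidef_fin_two_of_imaginary_offDiag ha hdet using 1
    ext i j
    fin_cases i <;> fin_cases j <;>
      simp [Matrix.mul_apply, Fin.sum_univ_two, Matrix.conjTranspose_apply] <;>
      field_simp <;> ring_nf <;> simp only [Complex.I_sq] <;> ring
end

section
/- Let σ = 2 and let 0 < ε < 1; set μ := 1 − ε. For every k ∈ ℤ with k ≠ 0, define the complex 2×2 matrices C_k := [[0, ik],[ik, 2]] and P_{ε,k} := [[1, −i(2−ε²)/(k(2+ε²))],[i(2−ε²)/(k(2+ε²)), 1]]. Then P_{ε,k} is Hermitian positive definite, and the Hermitian matrix C_k* P_{ε,k} + P_{ε,k} C_k − 2μ P_{ε,k} is positive definite, where C_k* denotes the conjugate transpose. -/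
open Matrix
open scoped ComplexOrder

/-- A `2 × 2` Hermitian matrix with real diagonal and purely imaginary off-diagonal entries is
positive definite as soon as its leading principal minors are positive. -/
theorem posDef_of_imaginary_offDiag {p q s : ℝ} (hp : 0 < p) (hdet : s ^ 2 < p * q) :
    (!![(p : ℂ), -(Complex.I * s); Complex.I * s, (q : ℂ)] : Matrix (Fin 2) (Fin 2) ℂ).PosDef := by
  refine Matrix.posDef_iff_dotProduct_mulVec.2 ⟨?_, fun {x} hx => ?_⟩
  · ext i j
    fin_cases i <;> fin_cases j <;> simp [Matrix.conjTranspose_apply]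
  · obtain ⟨a, b, hab⟩ : ∃ a b : ℝ, x 0 = a + b * Complex.I := ⟨_, _, (Complex.re_add_im _).symm⟩
    obtain ⟨c, d, hcd⟩ : ∃ c d : ℝ, x 1 = c + d * Complex.I := ⟨_, _, (Complex.re_add_im _).symm⟩
    have hform : star x ⬝ᵥ (!![(p : ℂ), -(Complex.I * s); Complex.I * s, (q : ℂ)] *ᵥ x) =
        ((p * (a ^ 2 + b ^ 2) + q * (c ^ 2 + d ^ 2) + 2 * s * (a * d - b * c) : ℝ) : ℂ) := by
      apply Complex.ext <;>
        simp [Matrix.mulVec, dotProduct, Fin.sum_univ_two, hab, hcd, pow_two] <;> ring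
    rw [hform, Complex.zero_lt_real]
    have hsq : p * (p * (a ^ 2 + b ^ 2) + q * (c ^ 2 + d ^ 2) + 2 * s * (a * d - b * c)) =
        (p * a + s * d) ^ 2 + (p * b - s * c) ^ 2 + (p * q - s ^ 2) * (c ^ 2 + d ^ 2) := by ring
    refine pos_of_mul_pos_right (a := p) ?_ hp.le
    rw [hsq]
    by_cases hy : c ^ 2 + d ^ 2 = 0
    · obtain rfl : c = 0 := by nlinarith
      obtain rfl : d = 0 := by nlinarith
      have hne : a ≠ 0 ∨ b ≠ 0 := by
        by_contra! h
        apply hx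
        ext i
        fin_cases i <;> simp [hab, hcd, h]
      rcases hne with h | h <;> simp only [mul_zero, add_zero, sub_zero] <;> positivity
    · have hcd_pos : 0 < c ^ 2 + d ^ 2 := lt_of_le_of_ne (by positivity) (Ne.symm hy)
      have := mul_pos (sub_pos.2 hdet) hcd_pos
      positivity

/-- Lemma 4.3: for σ = 2, 0 < ε < 1 and μ = 1 − ε, the matrices P_{ε,k}^suff satisfy
C_k* P_{ε,k} + P_{ε,k} C_k − 2μ P_{ε,k} > 0 for all modes k ≠ 0. -/
theorem gt_matrix_inequality_sigma_eq_two
    (ε : ℝ) (hε0 : 0 < ε) (hε1 : ε < 1) (k : ℤ) (hk : k ≠ 0) :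
    ((!![1, -Complex.I * ((2 - ε ^ 2 : ℝ) : ℂ) / ((k : ℂ) * ((2 + ε ^ 2 : ℝ) : ℂ));
        Complex.I * ((2 - ε ^ 2 : ℝ) : ℂ) / ((k : ℂ) * ((2 + ε ^ 2 : ℝ) : ℂ)), 1] :
          Matrix (Fin 2) (Fin 2) ℂ)).PosDef ∧
    ((!![0, Complex.I * (k : ℂ); Complex.I * (k : ℂ), (2 : ℂ)] : Matrix (Fin 2) (Fin 2) ℂ)ᴴ *
        !![1, -Complex.I * ((2 - ε ^ 2 : ℝ) : ℂ) / ((k : ℂ) * ((2 + ε ^ 2 : ℝ) : ℂ));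
            Complex.I * ((2 - ε ^ 2 : ℝ) : ℂ) / ((k : ℂ) * ((2 + ε ^ 2 : ℝ) : ℂ)), 1] +
      (!![1, -Complex.I * ((2 - ε ^ 2 : ℝ) : ℂ) / ((k : ℂ) * ((2 + ε ^ 2 : ℝ) : ℂ));
          Complex.I * ((2 - ε ^ 2 : ℝ) : ℂ) / ((k : ℂ) * ((2 + ε ^ 2 : ℝ) : ℂ)), 1] :
            Matrix (Fin 2) (Fin 2) ℂ) *
        !![0, Complex.I * (k : ℂ); Complex.I * (k : ℂ), (2 : ℂ)] -
      (((2 * (1 - ε) : ℝ) : ℂ)) •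
        !![1, -Complex.I * ((2 - ε ^ 2 : ℝ) : ℂ) / ((k : ℂ) * ((2 + ε ^ 2 : ℝ) : ℂ));
            Complex.I * ((2 - ε ^ 2 : ℝ) : ℂ) / ((k : ℂ) * ((2 + ε ^ 2 : ℝ) : ℂ)), 1]).PosDef := by
  have hk1 : (1 : ℝ) ≤ (k : ℝ) ^ 2 := by
    have : 0 < k ^ 2 := by positivity
    exact_mod_cast this
  have hkC : (k : ℂ) ≠ 0 := by exact_mod_cast hk
  have hden : 0 < 2 + ε ^ 2 := by positivity
  obtain ⟨a, ha⟩ : ∃ a : ℝ, a = (2 - ε ^ 2) / (2 + ε ^ 2) := ⟨_, rfl⟩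
  have ha_div : ((2 - ε ^ 2 : ℝ) : ℂ) / ((k : ℂ) * ((2 + ε ^ 2 : ℝ) : ℂ)) = ((a / k : ℝ) : ℂ) := by
    rw [ha]; push_cast; rw [div_div, mul_comm (k : ℂ)]
  have hoff : Complex.I * ((2 - ε ^ 2 : ℝ) : ℂ) / ((k : ℂ) * ((2 + ε ^ 2 : ℝ) : ℂ)) =
      Complex.I * ((a / k : ℝ) : ℂ) := by rw [mul_div_assoc, ha_div]
  have hoff' : -Complex.I * ((2 - ε ^ 2 : ℝ) : ℂ) / ((k : ℂ) * ((2 + ε ^ 2 : ℝ) : ℂ)) =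
      -(Complex.I * ((a / k : ℝ) : ℂ)) := by rw [mul_div_assoc, ha_div, neg_mul]
  have hb : (a / k) ^ 2 ≤ a ^ 2 := by
    rw [div_pow]; exact div_le_self (sq_nonneg a) hk1
  have hε2 : 0 < ε ^ 2 := by positivity
  have hε2_lt : ε ^ 2 < 1 := by nlinarith
  have ha0 : 0 < a := by rw [ha]; exact div_pos (by linarith) hden
  have ha1 : a < 1 := by rw [ha, div_lt_one hden]; linarith
  have haε : 0 < a - 1 + ε := by
    have : a - 1 + ε = ε * ((1 - ε) ^ 2 + 1) / (2 + ε ^ 2) := by rw [ha]; field_simp; ring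
    rw [this]; positivity
  have hdet : (ε * (a / k)) ^ 2 < (a - 1 + ε) * (1 - a + ε) := by
    have hgap : (a - 1 + ε) * (1 - a + ε) - (ε * a) ^ 2 = 4 * ε ^ 4 / (2 + ε ^ 2) ^ 2 := by
      rw [ha]; field_simp; ring
    have hpos : 0 < 4 * ε ^ 4 / (2 + ε ^ 2) ^ 2 := by positivity
    have := mul_le_mul_of_nonneg_left hb hε2.le
    rw [mul_pow] at hgap ⊢
    linarith
  rw [hoff, hoff']
  constructor
  · have := posDef_of_imaginary_offDiag (p := 1) (q := 1) (s := a / k) one_pos (by nlinarith)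
    simpa using this
  · have hkb : (k : ℂ) * ((a / k : ℝ) : ℂ) = a := by push_cast; field_simp
    convert posDef_of_imaginary_offDiag (p := 2 * (a - 1 + ε)) (q := 2 * (1 - a + ε))
      (s := 2 * (ε * (a / k))) (by linarith) (by nlinarith) using 1
    generalize a / (k : ℝ) = b at hkb
    have hI := Complex.I_mul_I
    have hconj : (starRingEnd ℂ) 2 = 2 := map_ofNat _ 2
    ext i j
    fin_cases i <;> fin_cases j <;>
      simp [Matrix.mul_apply, Fin.sum_univ_two, Matrix.conjTranspose_apply, hconj]
    · linear_combination (-2 * (k : ℂ) * b) * hI + 2 * hkb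
    · ring
    · ring
    · linear_combination (2 * (k : ℂ) * b) * hI - 2 * hkb
end

section
/- Let 0 < σ_min < σ_max < ∞ be real numbers. Define θ* := min(σ_min, 4/σ_max), and α* := σ_min(4 + 2√(4−σ_min²) − σ_min σ_max)/(4 + 2√(4−σ_min²) − σ_min²) if σ_min < 4/σ_max, α* := σ_max − √(σ_max² − 4) if σ_min ≥ 4/σ_max. Then 0 < θ*, α* < 2 and the pair (θ*, α*) satisfies: α* < θ*, θ* + α* < 2σ_min, and for every s ∈ [σ_min, σ_max], (θ*)²(s − α*)² − 4(θ* − α*)(2s − θ* − α*) ≤ 0. -/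
/-- With `w = √(4 - θ²)`, the quadratic condition is `4 (s - θ)² ≤ w² (s - α)²`. -/
lemma quadratic_condition_of_two_mul_le {θ α s w : ℝ} (hw : w ^ 2 = 4 - θ ^ 2) (hs : θ ≤ s)
    (h : 2 * (s - θ) ≤ w * (s - α)) :
    θ ^ 2 * (s - α) ^ 2 - 4 * (θ - α) * (2 * s - θ - α) ≤ 0 := by
  have hsq : (2 * (s - θ)) ^ 2 ≤ (w * (s - α)) ^ 2 :=
    pow_le_pow_left₀ (by linarith) h 2
  rw [mul_pow w, hw] at hsq
  linarith

/-- Lemma 5.3: the pair (θ*, α*) satisfies conditions (I) and (II) of Theorem 5.1. -/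
theorem theta_alpha_star_satisfy_conditions
    (smin smax : ℝ) (h0 : 0 < smin) (h1 : smin < smax) :
    0 < min smin (4 / smax) ∧ min smin (4 / smax) < 2 ∧
    0 < (if smin < 4 / smax then
          smin * (4 + 2 * Real.sqrt (4 - smin ^ 2) - smin * smax) /
            (4 + 2 * Real.sqrt (4 - smin ^ 2) - smin ^ 2)
        else smax - Real.sqrt (smax ^ 2 - 4)) ∧
    (if smin < 4 / smax then
        smin * (4 + 2 * Real.sqrt (4 - smin ^ 2) - smin * smax) /
          (4 + 2 * Real.sqrt (4 - smin ^ 2) - smin ^ 2)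
      else smax - Real.sqrt (smax ^ 2 - 4)) < 2 ∧
    (if smin < 4 / smax then
        smin * (4 + 2 * Real.sqrt (4 - smin ^ 2) - smin * smax) /
          (4 + 2 * Real.sqrt (4 - smin ^ 2) - smin ^ 2)
      else smax - Real.sqrt (smax ^ 2 - 4)) < min smin (4 / smax) ∧
    min smin (4 / smax) +
      (if smin < 4 / smax then
          smin * (4 + 2 * Real.sqrt (4 - smin ^ 2) - smin * smax) /
            (4 + 2 * Real.sqrt (4 - smin ^ 2) - smin ^ 2)
        else smax - Real.sqrt (smax ^ 2 - 4)) < 2 * smin ∧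
    ∀ s ∈ Set.Icc smin smax,
      (min smin (4 / smax)) ^ 2 *
          (s - (if smin < 4 / smax then
              smin * (4 + 2 * Real.sqrt (4 - smin ^ 2) - smin * smax) /
                (4 + 2 * Real.sqrt (4 - smin ^ 2) - smin ^ 2)
            else smax - Real.sqrt (smax ^ 2 - 4))) ^ 2 -
        4 * (min smin (4 / smax) -
            (if smin < 4 / smax then
                smin * (4 + 2 * Real.sqrt (4 - smin ^ 2) - smin * smax) /
                  (4 + 2 * Real.sqrt (4 - smin ^ 2) - smin ^ 2)
              else smax - Real.sqrt (smax ^ 2 - 4))) *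
          (2 * s - min smin (4 / smax) -
            (if smin < 4 / smax then
                smin * (4 + 2 * Real.sqrt (4 - smin ^ 2) - smin * smax) /
                  (4 + 2 * Real.sqrt (4 - smin ^ 2) - smin ^ 2)
              else smax - Real.sqrt (smax ^ 2 - 4))) ≤ 0 := by
  have hM : 0 < smax := h0.trans h1
  by_cases h : smin < 4 / smax
  · simp only [if_pos h, min_eq_left h.le]
    have hmM : smin * smax < 4 := (lt_div_iff₀ hM).1 h
    have hm4 : 0 < 4 - smin ^ 2 := by nlinarith
    have hm2 : smin < 2 := by nlinarith
    set w := Real.sqrt (4 - smin ^ 2)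
    have hw0 : 0 < w := Real.sqrt_pos.2 hm4
    have hw : w ^ 2 = 4 - smin ^ 2 := Real.sq_sqrt hm4.le
    have hD : 0 < 4 + 2 * w - smin ^ 2 := by linarith
    set α := smin * (4 + 2 * w - smin * smax) / (4 + 2 * w - smin ^ 2) with hα
    have hα0 : 0 < α := div_pos (mul_pos h0 (by linarith)) hD
    have hαm : α < smin := by
      rw [hα, div_lt_iff₀ hD]
      nlinarith [mul_pos h0 (mul_pos h0 (sub_pos.2 h1))]
    have hx : w * (smin - α) = (2 - w) * (smax - smin) := by
      have hD' : 4 + 2 * w - smin ^ 2 = w * (w + 2) := by linarith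
      have hαD : α * (w * (w + 2)) = smin * (4 + 2 * w - smin * smax) := by
        rw [← hD', hα, div_mul_cancel₀ _ hD.ne']
      apply mul_right_cancel₀ (show w + 2 ≠ 0 by positivity)
      linear_combination -hαD + smax * hw
    refine ⟨h0, hm2, hα0, hαm.trans hm2, hαm, by linarith, fun s hs => ?_⟩
    refine quadratic_condition_of_two_mul_le hw hs.1 ?_
    have hw2 : w ≤ 2 := by nlinarith
    nlinarith [mul_nonneg (sub_nonneg.2 hw2) (sub_nonneg.2 hs.2)]
  · simp only [if_neg h, min_eq_right (not_lt.1 h)]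
    have hθm : 4 / smax ≤ smin := not_lt.1 h
    have hmM : 4 ≤ smin * smax := (div_le_iff₀ hM).1 hθm
    have hM4 : 0 < smax ^ 2 - 4 := by nlinarith
    have hM2 : 2 < smax := by nlinarith
    set r := Real.sqrt (smax ^ 2 - 4)
    have hr0 : 0 < r := Real.sqrt_pos.2 hM4
    have hr : r ^ 2 = smax ^ 2 - 4 := Real.sq_sqrt hM4.le
    have hrM : r < smax := by nlinarith
    have hθ2 : 4 / smax < 2 := by rw [div_lt_iff₀ hM]; linarith
    have hαθ : smax - r < 4 / smax := by
      rw [lt_div_iff₀ hM]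
      nlinarith
    refine ⟨by positivity, hθ2, by linarith, hαθ.trans hθ2, hαθ, by linarith, fun s hs => ?_⟩
    have hw : (2 * r / smax) ^ 2 = 4 - (4 / smax) ^ 2 := by
      field_simp
      linear_combination 4 * hr
    refine quadratic_condition_of_two_mul_le hw (hθm.trans hs.1) ?_
    have hx : 2 * r / smax * (s - (smax - r)) - 2 * (s - 4 / smax) =
        2 * (smax - r) * (smax - s) / smax := by
      field_simp
      linear_combination hr
    have : 0 ≤ 2 * (smax - r) * (smax - s) / smax :=
      div_nonneg (mul_nonneg (by linarith) (sub_nonneg.2 hs.2)) hM.le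
    linarith
end

section
/- Let 0 < σ_min < σ_max be real numbers. For 0 < θ < 2 define γ_min(θ) := θ(2√(4−θ²) − (4 − σ_min θ))/(2√(4−θ²) − (4−θ²)) and γ_max(θ) := θ(2√(4−θ²) + (4 − σ_max θ))/(2√(4−θ²) + (4−θ²)). If 0 < θ < 2 and θ ≤ σ_min, then γ_max(θ) ≤ γ_min(θ). -/
/-- Claim (i) in the proof of Lemma 5.3: γ_max(θ) ≤ γ_min(θ) for θ ≤ σ_min, 0 < θ < 2. -/
theorem gamma_max_le_gamma_min
    (smin smax θ : ℝ) (h0 : 0 < smin) (h1 : smin < smax)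
    (hθ0 : 0 < θ) (hθ2 : θ < 2) (hθs : θ ≤ smin) :
    θ * (2 * Real.sqrt (4 - θ ^ 2) + (4 - smax * θ)) /
        (2 * Real.sqrt (4 - θ ^ 2) + (4 - θ ^ 2)) ≤
      θ * (2 * Real.sqrt (4 - θ ^ 2) - (4 - smin * θ)) /
        (2 * Real.sqrt (4 - θ ^ 2) - (4 - θ ^ 2)) := by
  have hpos : 0 < 4 - θ ^ 2 := by nlinarith
  have hs : 0 < Real.sqrt (4 - θ ^ 2) := Real.sqrt_pos.mpr hpos
  have hsq : Real.sqrt (4 - θ ^ 2) ^ 2 = 4 - θ ^ 2 := Real.sq_sqrt hpos.le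
  have hden : 0 < 2 * Real.sqrt (4 - θ ^ 2) - (4 - θ ^ 2) := by
    have hs2 : Real.sqrt (4 - θ ^ 2) < 2 := by nlinarith
    nlinarith
  have hmin : θ ^ 2 ≤ smin * θ := by nlinarith
  have hmax : θ ^ 2 ≤ smax * θ := by nlinarith
  -- Both quantities are separated by `θ`.
  trans θ
  · rw [div_le_iff₀ (by positivity)]
    exact mul_le_mul_of_nonneg_left (by linarith) hθ0.le
  · rw [le_div_iff₀ hden]
    exact mul_le_mul_of_nonneg_left (by linarith) hθ0.le
end

section
/- Let σ_max > 0 be a real number. For 0 < θ < 2 define γ_max(θ) := θ(2√(4−θ²) + (4 − σ_max θ))/(2√(4−θ²) + (4−θ²)). If 0 < θ < 2, θ ≤ 4/σ_max and θ < σ_max, then 0 < γ_max(θ) < θ. -/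
/-- Claim (ii) in the proof of Lemma 5.3: 0 < γ_max(θ) < θ for θ ≤ 4/σ_max, θ < σ_max. -/
theorem gamma_max_pos_lt_theta
    (smax θ : ℝ) (h0 : 0 < smax)
    (hθ0 : 0 < θ) (hθ2 : θ < 2) (hθ4 : θ ≤ 4 / smax) (hθs : θ < smax) :
    0 < θ * (2 * Real.sqrt (4 - θ ^ 2) + (4 - smax * θ)) /
          (2 * Real.sqrt (4 - θ ^ 2) + (4 - θ ^ 2)) ∧
      θ * (2 * Real.sqrt (4 - θ ^ 2) + (4 - smax * θ)) /
          (2 * Real.sqrt (4 - θ ^ 2) + (4 - θ ^ 2)) < θ := by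
  have hd : 0 < 4 - θ ^ 2 := by nlinarith
  have hs : 0 < Real.sqrt (4 - θ ^ 2) := Real.sqrt_pos.2 hd
  have hle : smax * θ ≤ 4 := by
    rw [le_div_iff₀ h0] at hθ4
    linarith
  have hlt : θ ^ 2 < smax * θ := by nlinarith
  constructor
  · exact div_pos (mul_pos hθ0 (by linarith)) (by linarith)
  · rw [div_lt_iff₀ (by linarith)]
    exact mul_lt_mul_of_pos_left (by linarith) hθ0
end

section
/- Let σ : 𝕋 → ℝ be continuous with σ_min := inf_{x∈𝕋} σ(x) > 0, and let u₁, u₂, u₃ be a real-valued classical solution of the 3-velocity Goldstein–Taylor system ∂ₜu₁ + √(2/3) ∂ₓu₂ = 0, ∂ₜu₂ + √(2/3) ∂ₓu₁ + (1/√3) ∂ₓu₃ = −σ(x)u₂, ∂ₜu₃ + (1/√3) ∂ₓu₂ = −σ(x)u₃ on 𝕋 × (0,∞), with initial data u₁,₀, u₂,₀, u₃,₀; set u∞ := (u₁,₀)_avg. Suppose θ > 0 and α > 0 satisfy: (I) √(2/3)·θ + α < 2σ_min and α ≤ √(2/3)·θ, and (II) sup_{x∈𝕋} [θ²(σ(x)−α)²/(8σ(x)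 − 4√(2/3)·θ − 4α)] + sup_{x∈𝕋} [θ²/(12(2σ(x)−α))] ≤ √(2/3)·θ − α. Then for all t ≥ 0: 𝔈_θ(u₁(·,t) − u∞, u₂(·,t), u₃(·,t)) ≤ 𝔈_θ(u₁,₀ − u∞, u₂,₀, u₃,₀) · e^{−αt}. -/
open MeasureTheory Real

/-- The three-component entropy 𝔈_θ(f,g,h). -/
noncomputable def entropy3 (θ : ℝ) (f g h : ℝ → ℝ) : ℝ :=
  nsq f + nsq g + nsq h - (θ / (2 * π)) * ∫ x in (0:ℝ)..(2 * π), antider f x * g x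

/-- **Wirtinger's inequality** for mean-zero functions of period `2π`. -/
theorem integral_sq_le_integral_sq_deriv {A p : ℝ → ℝ} (hA : ∀ x, HasDerivAt A (p x) x)
    (hp : Continuous p) (hper : A (2 * π) = A 0) (hmean : ∫ x in (0:ℝ)..(2 * π), A x = 0) :
    ∫ x in (0:ℝ)..(2 * π), A x ^ 2 ≤ ∫ x in (0:ℝ)..(2 * π), p x ^ 2 := by
  have hab : (0:ℝ) < 2 * π := by positivity
  have hAc : Continuous A := continuous_iff_continuousAt.2 fun x => (hA x).continuousAt
  have memLp_ofReal : ∀ f : ℝ → ℝ, Continuous f →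
      MemLp (fun x => (f x : ℂ)) 2 (volume.restrict (Set.Ioc 0 (2 * π))) := fun f hf => by
    have hf' : Continuous fun x => (f x : ℂ) := Complex.continuous_ofReal.comp hf
    obtain ⟨C, hC⟩ := isCompact_Icc.exists_bound_of_continuousOn (s := Set.Icc (0:ℝ) (2 * π))
      hf'.continuousOn
    exact MemLp.of_bound hf'.aestronglyMeasurable C
      ((ae_restrict_iff' measurableSet_Ioc).2 (Filter.Eventually.of_forall fun x hx =>
        hC x (Set.Ioc_subset_Icc_self hx)))
  have sA := hasSum_sq_fourierCoeffOn hab (memLp_ofReal A hAc)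
  have sp := hasSum_sq_fourierCoeffOn hab (memLp_ofReal p hp)
  have key := hasSum_le (fun n => ?_) sA sp
  · simp only [Complex.norm_real, Real.norm_eq_abs, sq_abs, smul_eq_mul] at key
    exact le_of_mul_le_mul_left key (by positivity)
  · rcases eq_or_ne n 0 with rfl | hn
    · have : fourierCoeffOn hab (fun x => (A x : ℂ)) 0 = 0 := by
        rw [fourierCoeffOn_eq_integral]
        simp [intervalIntegral.integral_ofReal, hmean]
      rw [this]
      simp
    · have h := fourierCoeffOn_of_hasDerivAt hab (f := fun x => (A x : ℂ))
        (f' := fun x => (p x : ℂ)) hn (fun x _ => (hA x).ofReal_comp)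
        ((Complex.continuous_ofReal.comp hp).intervalIntegrable _ _)
      rw [h, hper]
      have h1 : (1:ℝ) ≤ |(n:ℝ)| := by exact_mod_cast Int.one_le_abs hn
      have h2 : ‖fourierCoeffOn hab (fun x => (p x : ℂ)) n‖ / |(n:ℝ)| ≤
          ‖fourierCoeffOn hab (fun x => (p x : ℂ)) n‖ := div_le_self (norm_nonneg _) h1
      refine pow_le_pow_left₀ (norm_nonneg _) (le_trans (le_of_eq ?_) h2) 2
      simp only [sub_self, mul_zero, zero_sub, norm_mul, norm_neg, norm_div, norm_one,
        Complex.norm_real, Complex.norm_I, Complex.norm_intCast, Complex.norm_ofNat,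
        Real.norm_eq_abs, sub_zero, Complex.ofReal_mul, Complex.ofReal_ofNat, abs_of_pos pi_pos,
        Complex.ofReal_zero]
      have : |(n:ℝ)| ≠ 0 := by positivity
      field_simp

/-- Leibniz rule on the open half-line for integrands with jointly continuous derivative. -/
theorem hasDerivAt_integral_of_continuousOn_Ioi {F F' : ℝ → ℝ → ℝ}
    (hF : ∀ t, 0 < t → Continuous (F t))
    (hF' : ContinuousOn (Function.uncurry F') (Set.Ioi 0 ×ˢ Set.univ))
    (hderiv : ∀ t, 0 < t → ∀ x, HasDerivAt (fun s => F s x) (F' t x) t)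
    (a b : ℝ) {t : ℝ} (ht : 0 < t) :
    HasDerivAt (fun s => ∫ x in a..b, F s x) (∫ x in a..b, F' t x) t := by
  have hK : IsCompact (Set.Icc (t / 2) (2 * t) ×ˢ Set.uIcc a b) :=
    isCompact_Icc.prod isCompact_uIcc
  obtain ⟨C, hC⟩ := hK.exists_bound_of_continuousOn (hF'.mono fun z hz =>
    ⟨lt_of_lt_of_le (by positivity) hz.1.1, Set.mem_univ _⟩)
  have hslice : Continuous (F' t) := by
    rw [← continuousOn_univ]
    exact hF'.comp (f := fun x => (t, x)) (by fun_prop) fun x _ => ⟨Set.mem_Ioi.2 ht, Set.mem_univ _⟩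
  refine (intervalIntegral.hasDerivAt_integral_of_dominated_loc_of_deriv_le
    (s := Set.Icc (t / 2) (2 * t)) (bound := fun _ => C)
    (Icc_mem_nhds (by linarith) (by linarith)) ?_ ((hF t ht).intervalIntegrable _ _)
    hslice.aestronglyMeasurable ?_ (by simp) ?_).2
  · filter_upwards [lt_mem_nhds ht] with s hs using (hF s hs).aestronglyMeasurable
  · exact Filter.Eventually.of_forall fun x hx s hs => hC (s, x) ⟨hs, Set.uIoc_subset_uIcc hx⟩
  · exact Filter.Eventually.of_forall fun x _ s hs =>
      hderiv s (lt_of_lt_of_le (by positivity) hs.1) x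

theorem mul_mul_le_of_sq_le {k S c : ℝ} (hk : 0 < k) (h : c ^ 2 / (4 * k) ≤ S) (x y : ℝ) :
    c * x * y ≤ k * y ^ 2 + S * x ^ 2 := by
  have h1 : c ^ 2 / (4 * k) * x ^ 2 ≤ S * x ^ 2 := by gcongr
  have h2 : k * y ^ 2 + c ^ 2 / (4 * k) * x ^ 2 - c * x * y = (c * x - 2 * k * y) ^ 2 / (4 * k) := by
    field_simp
    ring
  have h3 : 0 ≤ (c * x - 2 * k * y) ^ 2 / (4 * k) := by positivity
  linarith

/-- A jointly `C¹` function on the half-space has continuous partial derivatives in its interior. -/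
theorem partialDerivs_of_contDiffOn {u : ℝ → ℝ → ℝ}
    (hu : ContDiffOn ℝ 1 (Function.uncurry u) (Set.Ici (0:ℝ) ×ˢ Set.univ)) :
    ContinuousOn (Function.uncurry fun t x => deriv (u t) x) (Set.Ioi 0 ×ˢ Set.univ) ∧
      (∀ t, 0 < t → ∀ x, HasDerivAt (u t) (deriv (u t) x) x) ∧
      ∀ t, 0 < t → ∀ x, HasDerivAt (fun s => u s x) (deriv (fun s => u s x) t) t := by
  have hopen : IsOpen (Set.Ioi (0:ℝ) ×ˢ (Set.univ : Set ℝ)) := isOpen_Ioi.prod isOpen_univ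
  have hu' : ContDiffOn ℝ 1 (Function.uncurry u) (Set.Ioi (0:ℝ) ×ˢ Set.univ) :=
    hu.mono (Set.prod_mono Set.Ioi_subset_Ici_self le_rfl)
  have hd : ∀ t, 0 < t → ∀ x, HasFDerivAt (Function.uncurry u)
      (fderiv ℝ (Function.uncurry u) (t, x)) (t, x) := fun t ht x =>
    ((hu'.differentiableOn one_ne_zero).differentiableAt
      (hopen.mem_nhds (Set.mk_mem_prod ht (Set.mem_univ x)))).hasFDerivAt
  have hx : ∀ t, 0 < t → ∀ x,
      HasDerivAt (u t) (fderiv ℝ (Function.uncurry u) (t, x) (0, 1)) x := fun t ht x =>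
    (hd t ht x).comp_hasDerivAt x ((hasDerivAt_const x t).prodMk (hasDerivAt_id x))
  have ht' : ∀ t, 0 < t → ∀ x,
      HasDerivAt (fun s => u s x) (fderiv ℝ (Function.uncurry u) (t, x) (1, 0)) t := fun t ht x =>
    (hd t ht x).comp_hasDerivAt (f := fun s => (s, x)) t
      ((hasDerivAt_id' t).prodMk (hasDerivAt_const t x))
  refine ⟨?_, fun t ht x => (hx t ht x).differentiableAt.hasDerivAt,
    fun t ht x => (ht' t ht x).differentiableAt.hasDerivAt⟩
  refine ((hu'.continuousOn_fderiv_of_isOpen hopen le_rfl).clm_apply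
    (continuousOn_const (c := ((0:ℝ), (1:ℝ))))).congr fun z hz => ?_
  exact (hx z.1 hz.1 z.2).deriv

/-- Entropy production estimate at a fixed time, in integrated form. -/
theorem integral_entropy_production_nonpos {σ p q r A p' q' r' : ℝ → ℝ}
    {a b θ α S₁ S₂ m : ℝ} (hσ : Continuous σ) (hθa : 0 ≤ θ * a)
    (hp : ∀ x, HasDerivAt p (p' x) x) (hq : ∀ x, HasDerivAt q (q' x) x)
    (hr : ∀ x, HasDerivAt r (r' x) x) (hA : ∀ x, HasDerivAt A (p x) x)
    (hp'c : Continuous p') (hq'c : Continuous q') (hr'c : Continuous r')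
    (hpp : p (2 * π) = p 0) (hqp : q (2 * π) = q 0) (hrp : r (2 * π) = r 0)
    (hAp : A (2 * π) = A 0) (hAm : ∫ x in (0:ℝ)..(2 * π), A x = 0)
    (hm : ∫ x in (0:ℝ)..(2 * π), q x = 2 * π * m)
    (hk₁ : ∀ x, 0 < 2 * σ x - θ * a - α) (hk₂ : ∀ x, 0 < 2 * σ x - α)
    (hS₁ : ∀ x, (θ * (σ x - α)) ^ 2 / (4 * (2 * σ x - θ * a - α)) ≤ S₁)
    (hS₂ : ∀ x, (θ * b) ^ 2 / (4 * (2 * σ x - α)) ≤ S₂)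
    (hS : S₁ + S₂ ≤ θ * a - α) :
    (∫ x in (0:ℝ)..(2 * π), (2 * p x * (-(a * q' x)) +
        2 * q x * (-(a * p' x) - b * r' x - σ x * q x) + 2 * r x * (-(b * q' x) - σ x * r x) -
        θ * (-(a * (q x - m)) * q x + A x * (-(a * p' x) - b * r' x - σ x * q x)))) +
      α * (∫ x in (0:ℝ)..(2 * π), (p x ^ 2 + q x ^ 2 + r x ^ 2 - θ * (A x * q x))) ≤ 0 := by
  have hpc : Continuous p := continuous_iff_continuousAt.2 fun x => (hp x).continuousAt
  have hqc : Continuous q := continuous_iff_continuousAt.2 fun x => (hq x).continuousAt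
  have hrc : Continuous r := continuous_iff_continuousAt.2 fun x => (hr x).continuousAt
  have hAc : Continuous A := continuous_iff_continuousAt.2 fun x => (hA x).continuousAt
  have hS₁0 : 0 ≤ S₁ := le_trans (div_nonneg (sq_nonneg _) (by linarith [hk₁ 0])) (hS₁ 0)
  have hW := integral_sq_le_integral_sq_deriv hA hpc hAp hAm
  set Φ' : ℝ → ℝ := fun x =>
    -2 * a * (p' x * q x + p x * q' x) - 2 * b * (q' x * r x + q x * r' x) +
      θ * (p x * (a * p x + b * r x) + A x * (a * p' x + b * r' x)) with hΦ'
  have hΦ : ∀ x, HasDerivAt (fun x => -2 * a * (p x * q x) - 2 * b * (q x * r x) +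
      θ * (A x * (a * p x + b * r x))) (Φ' x) x := fun x =>
    ((((hp x).mul (hq x)).const_mul (-2 * a)).sub (((hq x).mul (hr x)).const_mul (2 * b))).add
      (((hA x).mul (((hp x).const_mul a).add ((hr x).const_mul b))).const_mul θ)
  have hΦc : Continuous Φ' := by fun_prop
  have hΦint : ∫ x in (0:ℝ)..(2 * π), Φ' x = 0 := by
    rw [intervalIntegral.integral_eq_sub_of_hasDerivAt (fun x _ => hΦ x)
      (hΦc.intervalIntegrable _ _), hpp, hqp, hrp, hAp, sub_self]
  have hpt : ∀ x, 2 * p x * (-(a * q' x)) +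
        2 * q x * (-(a * p' x) - b * r' x - σ x * q x) + 2 * r x * (-(b * q' x) - σ x * r x) -
        θ * (-(a * (q x - m)) * q x + A x * (-(a * p' x) - b * r' x - σ x * q x)) +
        α * (p x ^ 2 + q x ^ 2 + r x ^ 2 - θ * (A x * q x)) ≤
      Φ' x + ((α - θ * a + S₂) * p x ^ 2 + S₁ * A x ^ 2 - θ * a * m * q x) := fun x => by
    have h₁ := mul_mul_le_of_sq_le (hk₁ x) (hS₁ x) (A x) (q x)
    have h₂ := mul_mul_le_of_sq_le (hk₂ x) (by simpa using hS₂ x : (-(θ * b)) ^ 2 / _ ≤ S₂)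
      (p x) (r x)
    simp only [hΦ']
    linarith
  rw [← intervalIntegral.integral_const_mul, ← intervalIntegral.integral_add
    (Continuous.intervalIntegrable (by fun_prop) _ _)
    (Continuous.intervalIntegrable (by fun_prop) _ _)]
  refine (intervalIntegral.integral_mono (by positivity)
    (Continuous.intervalIntegrable (by fun_prop) _ _)
    (Continuous.intervalIntegrable (by fun_prop) _ _) hpt).trans ?_
  rw [intervalIntegral.integral_add (hΦc.intervalIntegrable _ _)
      (Continuous.intervalIntegrable (by fun_prop) _ _), hΦint,
    intervalIntegral.integral_sub (Continuous.intervalIntegrable (by fun_prop) _ _)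
      (Continuous.intervalIntegrable (by fun_prop) _ _),
    intervalIntegral.integral_add (Continuous.intervalIntegrable (by fun_prop) _ _)
      (Continuous.intervalIntegrable (by fun_prop) _ _),
    intervalIntegral.integral_const_mul, intervalIntegral.integral_const_mul,
    intervalIntegral.integral_const_mul, hm]
  have hP : 0 ≤ ∫ x in (0:ℝ)..(2 * π), p x ^ 2 :=
    intervalIntegral.integral_nonneg (by positivity) fun x _ => sq_nonneg _
  have h₃ := mul_le_mul_of_nonneg_left hW hS₁0
  have h₄ := mul_nonneg (sub_nonneg.2 hS) hP
  have h₅ : 0 ≤ θ * a * m * (2 * π * m) := by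
    rw [show θ * a * m * (2 * π * m) = θ * a * (2 * π) * m ^ 2 by ring]
    positivity
  linarith

theorem entropy3_eq_integral (θ : ℝ) {f g h : ℝ → ℝ} (hf : Continuous f) (hg : Continuous g)
    (hh : Continuous h) :
    entropy3 θ f g h = 1 / (2 * π) * ∫ x in (0:ℝ)..(2 * π),
      (f x ^ 2 + g x ^ 2 + h x ^ 2 - θ * (antider f x * g x)) := by
  have hA : Continuous (antider f) := by
    unfold antider
    exact (intervalIntegral.continuous_primitive (fun _ _ => hf.intervalIntegrable _ _) 0).sub
      continuous_const
  rw [intervalIntegral.integral_sub (Continuous.intervalIntegrable (by fun_prop) _ _)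
      (Continuous.intervalIntegrable (by fun_prop) _ _),
    intervalIntegral.integral_add (Continuous.intervalIntegrable (by fun_prop) _ _)
      (Continuous.intervalIntegrable (by fun_prop) _ _),
    intervalIntegral.integral_add (Continuous.intervalIntegrable (by fun_prop) _ _)
      (Continuous.intervalIntegrable (by fun_prop) _ _),
    intervalIntegral.integral_const_mul, entropy3, nsq, nsq, nsq]
  ring

/-- Entropy decay for solutions that are continuous in all of `ℝ × ℝ`, solve the system for
positive times and whose first component initially has mean zero. -/
theorem entropy3_decay_of_hasDerivAt {σ : ℝ → ℝ} {u v w ux vx wx : ℝ → ℝ → ℝ}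
    {a b θ α S₁ S₂ : ℝ} (hσ : Continuous σ) (hθa : 0 ≤ θ * a)
    (hu : Continuous (Function.uncurry u)) (hv : Continuous (Function.uncurry v))
    (hw : Continuous (Function.uncurry w))
    (hux : ContinuousOn (Function.uncurry ux) (Set.Ioi 0 ×ˢ Set.univ))
    (hvx : ContinuousOn (Function.uncurry vx) (Set.Ioi 0 ×ˢ Set.univ))
    (hwx : ContinuousOn (Function.uncurry wx) (Set.Ioi 0 ×ˢ Set.univ))
    (hup : ∀ t, u t (2 * π) = u t 0) (hvp : ∀ t, v t (2 * π) = v t 0)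
    (hwp : ∀ t, w t (2 * π) = w t 0)
    (hdux : ∀ t, 0 < t → ∀ x, HasDerivAt (u t) (ux t x) x)
    (hdvx : ∀ t, 0 < t → ∀ x, HasDerivAt (v t) (vx t x) x)
    (hdwx : ∀ t, 0 < t → ∀ x, HasDerivAt (w t) (wx t x) x)
    (hdut : ∀ t, 0 < t → ∀ x, HasDerivAt (fun s => u s x) (-(a * vx t x)) t)
    (hdvt : ∀ t, 0 < t → ∀ x,
      HasDerivAt (fun s => v s x) (-(a * ux t x) - b * wx t x - σ x * v t x) t)
    (hdwt : ∀ t, 0 < t → ∀ x,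
      HasDerivAt (fun s => w s x) (-(b * vx t x) - σ x * w t x) t)
    (hmean : ∫ x in (0:ℝ)..(2 * π), u 0 x = 0)
    (hk₁ : ∀ x, 0 < 2 * σ x - θ * a - α) (hk₂ : ∀ x, 0 < 2 * σ x - α)
    (hS₁ : ∀ x, (θ * (σ x - α)) ^ 2 / (4 * (2 * σ x - θ * a - α)) ≤ S₁)
    (hS₂ : ∀ x, (θ * b) ^ 2 / (4 * (2 * σ x - α)) ≤ S₂)
    (hS : S₁ + S₂ ≤ θ * a - α) {t : ℝ} (ht : 0 ≤ t) :
    entropy3 θ (u t) (v t) (w t) ≤ entropy3 θ (u 0) (v 0) (w 0) * Real.exp (-α * t) := by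
  have slice : ∀ {f : ℝ → ℝ → ℝ}, ContinuousOn (Function.uncurry f) (Set.Ioi 0 ×ˢ Set.univ) →
      ∀ s, 0 < s → Continuous (f s) := fun {f} hf s hs => by
    rw [← continuousOn_univ]
    exact hf.comp (f := fun x => (s, x)) (by fun_prop)
      fun x _ => ⟨Set.mem_Ioi.2 hs, Set.mem_univ _⟩
  have hus : ∀ s, Continuous (u s) := fun s => hu.uncurry_left s
  have hvs : ∀ s, Continuous (v s) := fun s => hv.uncurry_left s
  have hws : ∀ s, Continuous (w s) := fun s => hw.uncurry_left s
  have hGc : Continuous (Function.uncurry fun s x => ∫ y in (0:ℝ)..x, u s y) :=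
    intervalIntegral.continuous_parametric_primitive_of_continuous hu
  have hAc : Continuous (Function.uncurry fun s x => antider (u s) x) := by
    have : Continuous fun s => havg fun z => ∫ y in (0:ℝ)..z, u s y :=
      continuous_const.mul (intervalIntegral.continuous_parametric_intervalIntegral_of_continuous'
        hGc 0 (2 * π))
    exact hGc.sub (this.comp continuous_fst)
  have hdG : ∀ s, 0 < s → ∀ x,
      HasDerivAt (fun s => ∫ y in (0:ℝ)..x, u s y) (-(a * (v s x - v s 0))) s := fun s hs x => by
    convert! hasDerivAt_integral_of_continuousOn_Ioi (fun s _ => hus s)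
      (F' := fun s x => -(a * vx s x)) (continuousOn_const.mul hvx).neg hdut 0 x hs using 1
    simp only [intervalIntegral.integral_neg, intervalIntegral.integral_const_mul]
    rw [intervalIntegral.integral_eq_sub_of_hasDerivAt (fun y _ => hdvx s hs y)
      ((slice hvx s hs).intervalIntegrable _ _)]
  have hmean' : ∀ s, 0 ≤ s → ∫ x in (0:ℝ)..(2 * π), u s x = 0 := fun s hs => by
    rcases hs.eq_or_lt with rfl | hs
    · exact hmean
    obtain ⟨c, hc, h⟩ := exists_hasDerivAt_eq_slope (fun s => ∫ x in (0:ℝ)..(2 * π), u s x)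
      (fun s => -(a * (v s (2 * π) - v s 0))) hs
      (intervalIntegral.continuous_parametric_intervalIntegral_of_continuous'
        hu 0 (2 * π)).continuousOn fun r hr => hdG r hr.1 (2 * π)
    have h0 : 0 = (∫ x in (0:ℝ)..(2 * π), u s x) / s := by simpa [hvp, hmean] using h
    exact (div_eq_zero_iff.1 h0.symm).resolve_right hs.ne'
  have hdA : ∀ s, 0 < s → ∀ x,
      HasDerivAt (fun s => antider (u s) x) (-(a * (v s x - havg (v s)))) s := fun s hs x => by
    have h := hasDerivAt_integral_of_continuousOn_Ioi (fun s _ => hGc.uncurry_left s)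
      (F' := fun s x => -(a * (v s x - v s 0))) (by fun_prop) hdG 0 (2 * π) hs
    convert! (hdG s hs x).sub (h.const_mul (1 / (2 * π))) using 1
    rw [intervalIntegral.integral_neg, intervalIntegral.integral_const_mul,
      intervalIntegral.integral_sub ((hvs s).intervalIntegrable _ _)
        intervalIntegrable_const, intervalIntegral.integral_const, havg, smul_eq_mul]
    field_simp
    ring
  set J : ℝ → ℝ := fun s => ∫ x in (0:ℝ)..(2 * π),
    (u s x ^ 2 + v s x ^ 2 + w s x ^ 2 - θ * (antider (u s) x * v s x)) with hJ
  have hJc : Continuous J :=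
    intervalIntegral.continuous_parametric_intervalIntegral_of_continuous' (by fun_prop) _ _
  set J' : ℝ → ℝ := fun s => ∫ x in (0:ℝ)..(2 * π), (2 * u s x * (-(a * vx s x)) +
        2 * v s x * (-(a * ux s x) - b * wx s x - σ x * v s x) +
        2 * w s x * (-(b * vx s x) - σ x * w s x) -
        θ * (-(a * (v s x - havg (v s))) * v s x +
          antider (u s) x * (-(a * ux s x) - b * wx s x - σ x * v s x))) with hJ'
  have hdJ : ∀ s, 0 < s → HasDerivAt J (J' s) s := fun s hs => by
    refine hasDerivAt_integral_of_continuousOn_Ioi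
      (F := fun s x => u s x ^ 2 + v s x ^ 2 + w s x ^ 2 - θ * (antider (u s) x * v s x))
      (F' := fun s x => 2 * u s x * (-(a * vx s x)) +
        2 * v s x * (-(a * ux s x) - b * wx s x - σ x * v s x) +
        2 * w s x * (-(b * vx s x) - σ x * w s x) -
        θ * (-(a * (v s x - havg (v s))) * v s x +
          antider (u s) x * (-(a * ux s x) - b * wx s x - σ x * v s x))) ?_ ?_ ?_ 0 (2 * π) hs
    · intro s _
      have := hAc.uncurry_left s
      fun_prop
    · have hm : Continuous fun s => havg (v s) := continuous_const.mul
        (intervalIntegral.continuous_parametric_intervalIntegral_of_continuous' hv 0 (2 * π))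
      have general : ∀ {U V W X Y Z A M T : ℝ × ℝ → ℝ} {D : Set (ℝ × ℝ)}, ContinuousOn U D →
          ContinuousOn V D → ContinuousOn W D → ContinuousOn X D → ContinuousOn Y D →
          ContinuousOn Z D → ContinuousOn A D → ContinuousOn M D → ContinuousOn T D →
          ContinuousOn (fun z => 2 * U z * (-(a * Y z)) +
            2 * V z * (-(a * X z) - b * Z z - T z * V z) + 2 * W z * (-(b * Y z) - T z * W z) -
            θ * (-(a * (V z - M z)) * V z + A z * (-(a * X z) - b * Z z - T z * V z))) D := by
        intros
        fun_prop
      exact general hu.continuousOn hv.continuousOn hw.continuousOn hux hvx hwx hAc.continuousOn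
        (hm.comp continuous_fst).continuousOn (hσ.comp continuous_snd).continuousOn
    · intro s hs x
      convert! ((((hdut s hs x).pow 2).add ((hdvt s hs x).pow 2)).add ((hdwt s hs x).pow 2)).sub
        (((hdA s hs x).mul (hdvt s hs x)).const_mul θ) using 1
      simp
  have hprod : ∀ s, 0 < s → J' s + α * J s ≤ 0 := fun s hs => by
    refine integral_entropy_production_nonpos hσ hθa (hdux s hs) (hdvx s hs) (hdwx s hs) ?_
      (slice hux s hs) (slice hvx s hs) (slice hwx s hs) (hup s) (hvp s) (hwp s) ?_ ?_ ?_
      hk₁ hk₂ hS₁ hS₂ hS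
    · intro x
      exact ((hus s).integral_hasStrictDerivAt 0 x).hasDerivAt.sub_const _
    · simp only [antider, hmean' s hs.le, intervalIntegral.integral_same]
    · simp only [antider]
      rw [intervalIntegral.integral_sub ((hGc.uncurry_left s).intervalIntegrable _ _)
        intervalIntegrable_const, intervalIntegral.integral_const, havg, smul_eq_mul]
      field_simp
      ring
    · rw [havg]
      field_simp
  have hanti : AntitoneOn (fun s => J s * Real.exp (α * s)) (Set.Ici 0) := by
    have hd : ∀ s, 0 < s → HasDerivAt (fun s => J s * Real.exp (α * s))
        ((J' s + α * J s) * Real.exp (α * s)) s := fun s hs => by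
      convert! (hdJ s hs).mul (((hasDerivAt_id' s).const_mul α).exp) using 1
      ring
    refine antitoneOn_of_deriv_nonpos (convex_Ici 0) (by fun_prop) ?_ ?_
    · rw [interior_Ici]
      exact fun s hs => (hd s hs).differentiableAt.differentiableWithinAt
    · rw [interior_Ici]
      intro s hs
      rw [(hd s hs).deriv]
      exact mul_nonpos_of_nonpos_of_nonneg (hprod s hs) (Real.exp_pos _).le
  have hfin : J t ≤ J 0 * Real.exp (-α * t) := by
    have h := hanti Set.self_mem_Ici ht ht
    simp only [mul_zero, Real.exp_zero, mul_one] at h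
    rw [neg_mul, Real.exp_neg, ← div_eq_mul_inv, le_div_iff₀ (Real.exp_pos _)]
    exact h
  rw [entropy3_eq_integral θ (hus t) (hvs t) (hws t),
    entropy3_eq_integral θ (hus 0) (hvs 0) (hws 0), mul_assoc]
  gcongr

/-- Theorem 6.1: entropy decay for the 3-velocity Goldstein–Taylor model. -/
theorem gt3_entropy_decay
    (σ : ℝ → ℝ) (hσc : Continuous σ) (hσp : Function.Periodic σ (2 * π))
    (hmin : 0 < sInf (Set.range σ))
    (u₁ u₂ u₃ : ℝ → ℝ → ℝ) (u₁₀ u₂₀ u₃₀ : ℝ → ℝ)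
    (h1C : ContDiffOn ℝ 1 (Function.uncurry u₁) (Set.Ici (0:ℝ) ×ˢ Set.univ))
    (h2C : ContDiffOn ℝ 1 (Function.uncurry u₂) (Set.Ici (0:ℝ) ×ˢ Set.univ))
    (h3C : ContDiffOn ℝ 1 (Function.uncurry u₃) (Set.Ici (0:ℝ) ×ˢ Set.univ))
    (h1p : ∀ t, Function.Periodic (u₁ t) (2 * π))
    (h2p : ∀ t, Function.Periodic (u₂ t) (2 * π))
    (h3p : ∀ t, Function.Periodic (u₃ t) (2 * π))
    (hpde1 : ∀ t, 0 < t → ∀ x,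
      deriv (fun s => u₁ s x) t + Real.sqrt (2 / 3) * deriv (fun y => u₂ t y) x = 0)
    (hpde2 : ∀ t, 0 < t → ∀ x,
      deriv (fun s => u₂ s x) t + Real.sqrt (2 / 3) * deriv (fun y => u₁ t y) x +
        (1 / Real.sqrt 3) * deriv (fun y => u₃ t y) x = -σ x * u₂ t x)
    (hpde3 : ∀ t, 0 < t → ∀ x,
      deriv (fun s => u₃ s x) t + (1 / Real.sqrt 3) * deriv (fun y => u₂ t y) x
        = -σ x * u₃ t x)
    (h10 : ∀ x, u₁ 0 x = u₁₀ x) (h20 : ∀ x, u₂ 0 x = u₂₀ x) (h30 : ∀ x, u₃ 0 x = u₃₀ x)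
    (θ α : ℝ) (hθ : 0 < θ) (hα : 0 < α)
    (hI₁ : Real.sqrt (2 / 3) * θ + α < 2 * sInf (Set.range σ))
    (hI₂ : α ≤ Real.sqrt (2 / 3) * θ)
    (hII : sSup (Set.range (fun x =>
          θ ^ 2 * (σ x - α) ^ 2 / (8 * σ x - 4 * Real.sqrt (2 / 3) * θ - 4 * α))) +
        sSup (Set.range (fun x => θ ^ 2 / (12 * (2 * σ x - α)))) ≤
          Real.sqrt (2 / 3) * θ - α) :
    ∀ t, 0 ≤ t →
      entropy3 θ (fun x => u₁ t x - havg u₁₀) (u₂ t) (u₃ t) ≤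
        entropy3 θ (fun x => u₁₀ x - havg u₁₀) u₂₀ u₃₀ * Real.exp (-α * t) := by
  have hper0 : ∀ {f : ℝ → ℝ}, Function.Periodic f (2 * π) → f (2 * π) = f 0 := fun hf => by
    simpa using hf 0
  have h3 : (0:ℝ) < Real.sqrt 3 := by positivity
  have hb : (1 / Real.sqrt 3) ^ 2 = 1 / 3 := by
    rw [div_pow, Real.sq_sqrt (by norm_num), one_pow]
  have hθa : 0 ≤ θ * Real.sqrt (2 / 3) := by positivity
  have hpi : (2 * π) ≠ 0 := by positivity
  have hσbdd : BddBelow (Set.range σ) := (hσp.compact_of_continuous hpi hσc).bddBelow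
  have hσle : ∀ x, sInf (Set.range σ) ≤ σ x := fun x => csInf_le hσbdd ⟨x, rfl⟩
  have hk₁ : ∀ x, 0 < 2 * σ x - θ * Real.sqrt (2 / 3) - α := fun x => by linarith [hσle x]
  have hk₂ : ∀ x, 0 < 2 * σ x - α := fun x => by linarith [hk₁ x]
  have le_sSup : ∀ {f : ℝ → ℝ}, Continuous f → Function.Periodic f (2 * π) →
      ∀ x, f x ≤ sSup (Set.range f) := fun hf hfp x =>
    le_csSup (hfp.compact_of_continuous hpi hf).bddAbove ⟨x, rfl⟩
  have hS₁ := le_sSup (f := fun x =>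
      θ ^ 2 * (σ x - α) ^ 2 / (8 * σ x - 4 * Real.sqrt (2 / 3) * θ - 4 * α))
    (Continuous.div (by fun_prop) (by fun_prop) fun x => by
      have := hk₁ x
      exact ne_of_gt (by linarith)) fun x => by simp only [hσp x]
  have hS₂ := le_sSup (f := fun x => θ ^ 2 / (12 * (2 * σ x - α)))
    (Continuous.div (by fun_prop) (by fun_prop) fun x => by
      have := hk₂ x
      exact ne_of_gt (by linarith)) fun x => by simp only [hσp x]
  have hext : ∀ {u : ℝ → ℝ → ℝ},
      ContDiffOn ℝ 1 (Function.uncurry u) (Set.Ici (0:ℝ) ×ˢ Set.univ) →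
      Continuous (Function.uncurry fun t x => u (max t 0) x) := fun hu =>
    hu.continuousOn.comp_continuous (f := fun z : ℝ × ℝ => (max z.1 0, z.2)) (by fun_prop)
      fun z => ⟨Set.mem_Ici.2 (le_max_right _ _), Set.mem_univ _⟩
  have hloc : ∀ {u : ℝ → ℝ → ℝ} {t x d : ℝ}, 0 < t → HasDerivAt (fun s => u s x) d t →
      HasDerivAt (fun s => u (max s 0) x) d t := fun {u t x d} ht hd => by
    refine hd.congr_of_eventuallyEq ?_
    filter_upwards [lt_mem_nhds ht] with s hs
    rw [max_eq_left hs.le]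
  obtain ⟨c₁, hx₁, ht₁⟩ := partialDerivs_of_contDiffOn h1C
  obtain ⟨c₂, hx₂, ht₂⟩ := partialDerivs_of_contDiffOn h2C
  obtain ⟨c₃, hx₃, ht₃⟩ := partialDerivs_of_contDiffOn h3C
  obtain rfl : u₁ 0 = u₁₀ := funext h10
  obtain rfl : u₂ 0 = u₂₀ := funext h20
  obtain rfl : u₃ 0 = u₃₀ := funext h30
  intro t ht
  have hu₁₀ : Continuous (u₁ 0) := by simpa using (hext h1C).uncurry_left 0
  have h := entropy3_decay_of_hasDerivAt (σ := σ)
    (u := fun t x => u₁ (max t 0) x - havg (u₁ 0)) (v := fun t x => u₂ (max t 0) x)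
    (w := fun t x => u₃ (max t 0) x) (ux := fun t x => deriv (u₁ t) x)
    (vx := fun t x => deriv (u₂ t) x) (wx := fun t x => deriv (u₃ t) x)
    (a := Real.sqrt (2 / 3)) (b := 1 / Real.sqrt 3) (θ := θ) (α := α)
    hσc hθa ((hext h1C).sub continuous_const) (hext h2C) (hext h3C) c₁ c₂ c₃
    (fun t => by rw [hper0 (h1p _)]) (fun t => hper0 (h2p _)) (fun t => hper0 (h3p _))
    (fun t ht x => by simpa only [max_eq_left ht.le] using (hx₁ t ht x).sub_const _)
    (fun t ht x => by simpa only [max_eq_left ht.le] using hx₂ t ht x)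
    (fun t ht x => by simpa only [max_eq_left ht.le] using hx₃ t ht x)
    (fun t ht x => ((hloc ht (ht₁ t ht x)).sub_const _).congr_deriv (by
      linarith [hpde1 t ht x]))
    (fun t ht x => (hloc ht (ht₂ t ht x)).congr_deriv (by
      rw [max_eq_left ht.le]
      linarith [hpde2 t ht x]))
    (fun t ht x => (hloc ht (ht₃ t ht x)).congr_deriv (by
      rw [max_eq_left ht.le]
      linarith [hpde3 t ht x]))
    (by
      simp only [max_self]
      rw [intervalIntegral.integral_sub (hu₁₀.intervalIntegrable _ _) intervalIntegrable_const,
        intervalIntegral.integral_const, havg, smul_eq_mul]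
      field_simp
      ring)
    hk₁ hk₂
    (fun x => le_trans (le_of_eq (by ring_nf)) (hS₁ x))
    (fun x => le_trans (le_of_eq (by
      have := (hk₂ x).ne'
      rw [mul_pow, hb]
      field_simp
      norm_num)) (hS₂ x))
    (by linarith) ht
  simpa only [max_eq_left ht, max_self] using h
end

section
/- Let σ : 𝕋 → ℝ be continuous with 0 < σ_min := inf_{x∈𝕋} σ(x) and σ_max := sup_{x∈𝕋} σ(x) < ∞, and let u₁, u₂, u₃ be a real-valued classical solution of the 3-velocity Goldstein–Taylor system ∂ₜu₁ + √(2/3) ∂ₓu₂ = 0, ∂ₜu₂ + √(2/3) ∂ₓu₁ + (1/√3) ∂ₓu₃ = −σ(x)u₂, ∂ₜu₃ + (1/√3) ∂ₓu₂ = −σ(x)u₃ on 𝕋 × (0,∞), with initial data u₁,₀, u₂,₀, u₃,₀; set u∞ := (u₁,₀)_avg. Define α := min(σ_min/2, 3σ_min/(9σ_max² + 1)) and θ := √6 · α. Then for all t ≥ 0: 𝔈_θ(u₁(·,t) − u∞, u₂(·,t), u₃(·,t)) ≤ 𝔈_θ(u₁,₀ − u∞, u₂,₀, u₃,₀) ·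 e^{−αt}. -/
open MeasureTheory Real

open Set Filter Topology Function in
/-- A primitive of a jointly continuous function depends jointly continuously on the parameter and
the endpoint. -/
theorem continuousOn_parametric_primitive {φ : ℝ → ℝ → ℝ}
    (hφ : ContinuousOn (uncurry φ) (Ici (0:ℝ) ×ˢ univ)) :
    ContinuousOn (uncurry fun t x => ∫ y in (0:ℝ)..x, φ t y) (Ici (0:ℝ) ×ˢ univ) := by
  have hext : Continuous (uncurry fun t y => φ (max t 0) y) := by
    have : Continuous fun p : ℝ × ℝ => (max p.1 0, p.2) := by fun_prop
    exact hφ.comp_continuous this fun p => ⟨le_max_right p.1 0, mem_univ p.2⟩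
  have h := intervalIntegral.continuous_parametric_primitive_of_continuous
    (μ := volume) (a₀ := (0:ℝ)) hext
  refine h.continuousOn.congr fun p hp => ?_
  simp only [uncurry, max_eq_left (show (0:ℝ) ≤ p.1 from hp.1)]

open Set Filter Topology Function in
theorem continuousOn_parametric_integral {φ : ℝ → ℝ → ℝ}
    (hφ : ContinuousOn (uncurry φ) (Ici (0:ℝ) ×ˢ univ)) (b : ℝ) :
    ContinuousOn (fun t => ∫ y in (0:ℝ)..b, φ t y) (Ici (0:ℝ)) :=
  (continuousOn_parametric_primitive hφ).comp (f := fun t : ℝ => (t, b))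
    (by fun_prop) fun _ ht => ⟨ht, mem_univ _⟩

open Set Function in
theorem continuous_section {φ : ℝ → ℝ → ℝ} {S : Set ℝ}
    (hφ : ContinuousOn (uncurry φ) (S ×ˢ univ)) {t : ℝ} (ht : t ∈ S) : Continuous (φ t) :=
  hφ.comp_continuous (f := fun x : ℝ => (t, x)) (by fun_prop) fun _ => ⟨ht, mem_univ _⟩

open Set Filter Topology Function in
/-- Differentiation under the integral sign for jointly continuous derivatives. -/
theorem hasDerivAt_parametric_integral {φ φ' : ℝ → ℝ → ℝ}
    (hφ : ContinuousOn (uncurry φ) (Ici (0:ℝ) ×ˢ univ))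
    (hφ' : ContinuousOn (uncurry φ') (Ioi (0:ℝ) ×ˢ univ))
    (hd : ∀ t, 0 < t → ∀ x, HasDerivAt (fun s => φ s x) (φ' t x) t)
    {t : ℝ} (ht : 0 < t) (a b : ℝ) :
    HasDerivAt (fun s => ∫ x in a..b, φ s x) (∫ x in a..b, φ' t x) t := by
  have hpos : ∀ s ∈ Icc (t / 2) (t + 1), 0 < s := fun s hs => by linarith [hs.1]
  have hK : IsCompact (Icc (t / 2) (t + 1) ×ˢ uIcc a b) := isCompact_Icc.prod isCompact_uIcc
  obtain ⟨C, hC⟩ := hK.exists_bound_of_continuousOn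
    (hφ'.mono fun p hp => ⟨hpos _ hp.1, mem_univ _⟩)
  refine (intervalIntegral.hasDerivAt_integral_of_dominated_loc_of_deriv_le
    (F := φ) (F' := φ') (bound := fun _ => C) (s := Icc (t / 2) (t + 1))
    (Icc_mem_nhds (by linarith) (by linarith)) ?_ ?_ ?_ ?_ ?_ ?_).2
  · filter_upwards [lt_mem_nhds ht] with s hs
    exact (continuous_section hφ hs.le).aestronglyMeasurable
  · exact (continuous_section hφ ht.le).intervalIntegrable _ _
  · exact (continuous_section hφ' ht).aestronglyMeasurable
  · exact ae_of_all _ fun x hx s hs => hC (s, x) ⟨hs, uIoc_subset_uIcc hx⟩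
  · exact intervalIntegrable_const
  · exact ae_of_all _ fun x _ s hs => hd s (hpos s hs) x

open Set Filter Topology Function in
/-- A `C¹` function on `[0, ∞) × ℝ` has jointly continuous partial derivatives for positive
times. -/
theorem exists_partial_derivs {u : ℝ → ℝ → ℝ}
    (hu : ContDiffOn ℝ 1 (uncurry u) (Ici (0:ℝ) ×ˢ univ)) :
    ∃ ux : ℝ → ℝ → ℝ, ContinuousOn (uncurry ux) (Ioi (0:ℝ) ×ˢ univ) ∧
      ∀ t, 0 < t → ∀ x, DifferentiableAt ℝ (fun s => u s x) t ∧ HasDerivAt (u t) (ux t x) x := by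
  have hopen : IsOpen (Ioi (0:ℝ) ×ˢ (univ : Set ℝ)) := isOpen_Ioi.prod isOpen_univ
  have hu' := hu.mono (prod_mono_left (Ioi_subset_Ici_self (a := (0:ℝ))))
  have hfd := hu'.continuousOn_fderiv_of_isOpen hopen le_rfl
  refine ⟨fun t x => fderiv ℝ (uncurry u) (t, x) (0, 1), hfd.clm_apply continuousOn_const, ?_⟩
  intro t ht x
  have hdiff : DifferentiableAt ℝ (uncurry u) (t, x) :=
    (hu'.differentiableOn one_ne_zero).differentiableAt (hopen.mem_nhds ⟨ht, mem_univ _⟩)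
  constructor
  · exact DifferentiableAt.comp (g := uncurry u) (f := fun s => (s, x)) t hdiff (by fun_prop)
  · exact HasFDerivAt.comp_hasDerivAt (f := fun y => (t, y)) x hdiff.hasFDerivAt
      ((hasDerivAt_const x t).prodMk (hasDerivAt_id x))

open Set Filter Topology Function in
/-- Grönwall's inequality in exponential form. -/
theorem le_mul_exp_of_hasDerivAt_le {E E' : ℝ → ℝ} {α : ℝ} (hE : ContinuousOn E (Ici 0))
    (hd : ∀ t, 0 < t → HasDerivAt E (E' t) t) (hle : ∀ t, 0 < t → E' t ≤ -α * E t)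
    {t : ℝ} (ht : 0 ≤ t) : E t ≤ E 0 * Real.exp (-α * t) := by
  have hG : ∀ s, 0 < s → HasDerivAt (fun s => E s * Real.exp (α * s))
      (E' s * Real.exp (α * s) + E s * (Real.exp (α * s) * α)) s := fun s hs =>
    (hd s hs).mul (by simpa using ((hasDerivAt_id s).const_mul α).exp)
  have hanti : AntitoneOn (fun s => E s * Real.exp (α * s)) (Ici 0) := by
    refine antitoneOn_of_deriv_nonpos (convex_Ici 0) (hE.mul (by fun_prop)) ?_ ?_
    · intro s hs
      rw [interior_Ici] at hs
      exact (hG s hs).differentiableAt.differentiableWithinAt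
    · intro s hs
      rw [interior_Ici] at hs
      rw [(hG s hs).deriv]
      nlinarith [hle s hs, Real.exp_pos (α * s)]
  have h := hanti (mem_Ici.2 le_rfl) (mem_Ici.2 ht) ht
  simp only [mul_zero, Real.exp_zero, mul_one] at h
  rw [neg_mul, Real.exp_neg, ← div_eq_mul_inv, le_div_iff₀ (Real.exp_pos _)]
  exact h

open Set in
/-- Wirtinger's inequality for `2π`-periodic functions of mean zero. -/
theorem integral_sq_le_integral_deriv_sq {F f : ℝ → ℝ} (hf : Continuous f)
    (hF : ∀ x, HasDerivAt F (f x) x) (hper : F (2 * π) = F 0)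
    (hmean : ∫ x in (0:ℝ)..(2 * π), F x = 0) :
    ∫ x in (0:ℝ)..(2 * π), F x ^ 2 ≤ ∫ x in (0:ℝ)..(2 * π), f x ^ 2 := by
  have hπ : (0:ℝ) < 2 * π := Real.two_pi_pos
  have hFc : Continuous F := continuous_iff_continuousAt.2 fun x => (hF x).continuousAt
  have memLp : ∀ k : ℝ → ℝ, Continuous k →
      MemLp (fun x => (k x : ℂ)) 2 (volume.restrict (Ioc 0 (2 * π))) := fun k hk => by
    have hk' : Continuous fun x => (k x : ℂ) := by fun_prop
    obtain ⟨C, hC⟩ := (isCompact_Icc (a := (0:ℝ)) (b := 2 * π)).exists_bound_of_continuousOn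
      hk'.continuousOn
    refine MemLp.of_bound hk'.aestronglyMeasurable C ?_
    filter_upwards [ae_restrict_mem measurableSet_Ioc] with x hx
    exact hC x (Ioc_subset_Icc_self hx)
  have hsF := hasSum_sq_fourierCoeffOn hπ (memLp F hFc)
  have hsf := hasSum_sq_fourierCoeffOn hπ (memLp f hf)
  have hle := hasSum_le (fun n : ℤ => ?_) hsF hsf
  · simp only [sub_zero, Complex.norm_real, Real.norm_eq_abs, sq_abs, smul_eq_mul] at hle
    exact le_of_mul_le_mul_left hle (inv_pos.2 hπ)
  · rcases eq_or_ne n 0 with rfl | hn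
    · have : fourierCoeffOn hπ (fun x => (F x : ℂ)) 0 = 0 := by
        rw [fourierCoeffOn_eq_integral]
        simp [intervalIntegral.integral_ofReal, hmean]
      rw [this]
      rw [norm_zero, zero_pow two_ne_zero]
      exact sq_nonneg _
    · have hcoeff := fourierCoeffOn_of_hasDerivAt hπ (f := fun x => (F x : ℂ))
        (f' := fun x => (f x : ℂ)) hn (fun x _ => (hF x).ofReal_comp)
        ((Complex.continuous_ofReal.comp hf).intervalIntegrable _ _)
      rw [hcoeff, hper]
      have hn1 : (1:ℝ) ≤ |(n:ℝ)| := by exact_mod_cast Int.one_le_abs hn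
      have hnorm : ‖(1 / (-2 * π * Complex.I * n) : ℂ)‖ * (2 * π) ≤ 1 := by
        simp only [norm_div, norm_mul, norm_neg, norm_one, Complex.norm_I, Complex.norm_real,
          Complex.norm_intCast, Complex.norm_ofNat, Real.norm_eq_abs, abs_of_pos Real.pi_pos]
        rw [div_mul_eq_mul_div, div_le_one (by positivity)]
        nlinarith [Real.pi_pos]
      have hcast : ‖((2 * π : ℝ) : ℂ)‖ = 2 * π := by
        rw [Complex.norm_real, Real.norm_eq_abs, abs_of_pos hπ]
      gcongr
      simp only [sub_self, mul_zero, zero_sub, Complex.ofReal_zero, sub_zero, norm_mul, norm_neg,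
        hcast]
      rw [← mul_assoc]
      exact mul_le_of_le_one_left (norm_nonneg _) hnorm

theorem hasDerivAt_antider {f : ℝ → ℝ} (hf : Continuous f) (x : ℝ) :
    HasDerivAt (antider f) (f x) x :=
  (intervalIntegral.integral_hasDerivAt_right (hf.intervalIntegrable _ _)
    hf.aestronglyMeasurable.stronglyMeasurableAtFilter hf.continuousAt).sub_const _

theorem antider_two_pi {f : ℝ → ℝ} (hmean : ∫ x in (0:ℝ)..(2 * π), f x = 0) :
    antider f (2 * π) = antider f 0 := by
  simp [antider, hmean]

theorem integral_antider {f : ℝ → ℝ} (hf : Continuous f) :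
    ∫ x in (0:ℝ)..(2 * π), antider f x = 0 := by
  have hP : Continuous fun x => ∫ y in (0:ℝ)..x, f y :=
    intervalIntegral.continuous_primitive (fun _ _ => hf.intervalIntegrable _ _) 0
  have hπ := Real.pi_pos
  simp only [antider]
  rw [intervalIntegral.integral_sub (hP.intervalIntegrable _ _) intervalIntegrable_const,
    intervalIntegral.integral_const, havg, smul_eq_mul]
  field_simp
  ring

/-- The pointwise quadratic-form estimate behind the decay rate. -/
theorem entropy_density_le {s α m M F f g h : ℝ} (hα : 0 ≤ α) (hms : m ≤ s) (hsM : s ≤ M)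
    (hα2 : 2 * α ≤ m) (hαM : α * (9 * M ^ 2 + 1) ≤ 3 * m) :
    -2 * s * (g ^ 2 + h ^ 2) + 2 * α * g ^ 2 + √6 * α * s * F * g - 2 * α * f ^ 2
      - √2 * α * f * h + α * (f ^ 2 + g ^ 2 + h ^ 2 - √6 * α * (F * g))
      ≤ α * (5 / 6) * (F ^ 2 - f ^ 2) := by
  have h2 : √2 ^ 2 = 2 := Real.sq_sqrt (by norm_num)
  have h6 : √6 ^ 2 = 6 := Real.sq_sqrt (by norm_num)
  have hfh : -(√2 * f * h) ≤ f ^ 2 / 6 + 3 * h ^ 2 := by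
    nlinarith [sq_nonneg (f + 3 * √2 * h)]
  have hFg : √6 * (s - α) * (F * g) ≤ 5 / 6 * F ^ 2 + 9 / 5 * (s - α) ^ 2 * g ^ 2 := by
    have h := sq_nonneg (5 * F - 3 * (√6 * ((s - α) * g)))
    have hX : (√6 * ((s - α) * g)) ^ 2 = 6 * ((s - α) ^ 2 * g ^ 2) := by
      rw [mul_pow, h6, mul_pow]
    nlinarith
  have hs : (s - α) ^ 2 ≤ M ^ 2 := by
    apply pow_le_pow_left₀ <;> linarith
  have hg : 3 * α + 9 / 5 * α * (s - α) ^ 2 ≤ 2 * s := by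
    nlinarith [mul_le_mul_of_nonneg_left hs hα]
  nlinarith [mul_le_mul_of_nonneg_left hfh hα, mul_le_mul_of_nonneg_left hFg hα,
    mul_le_mul_of_nonneg_right hg (sq_nonneg g),
    mul_le_mul_of_nonneg_right (show 4 * α ≤ 2 * s by linarith) (sq_nonneg h)]

open Set Function in
/-- The integral of a jointly continuous function is conserved if its time derivative integrates
to zero. -/
theorem parametric_integral_eq {φ φ' : ℝ → ℝ → ℝ} {b : ℝ}
    (hφ : ContinuousOn (uncurry φ) (Ici (0:ℝ) ×ˢ univ))
    (hφ' : ContinuousOn (uncurry φ') (Ioi (0:ℝ) ×ˢ univ))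
    (hd : ∀ t, 0 < t → ∀ x, HasDerivAt (fun s => φ s x) (φ' t x) t)
    (hzero : ∀ t, 0 < t → ∫ x in (0:ℝ)..b, φ' t x = 0) {t : ℝ} (ht : 0 ≤ t) :
    ∫ x in (0:ℝ)..b, φ t x = ∫ x in (0:ℝ)..b, φ 0 x := by
  have hc := continuousOn_parametric_integral hφ b
  have hder : ∀ s, 0 < s → HasDerivAt (fun s => ∫ x in (0:ℝ)..b, φ s x) 0 s := fun s hs => by
    exact (hasDerivAt_parametric_integral hφ hφ' hd hs 0 b).congr_deriv (hzero s hs)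
  apply le_antisymm
  · have := le_mul_exp_of_hasDerivAt_le (α := 0) hc hder (by simp) ht
    simpa using this
  · have := le_mul_exp_of_hasDerivAt_le (α := 0) hc.neg (fun s hs => (hder s hs).neg) (by simp) ht
    simpa using this

open Set Function in
theorem continuousOn_antider {f : ℝ → ℝ → ℝ}
    (hf : ContinuousOn (uncurry f) (Ici (0:ℝ) ×ˢ univ)) :
    ContinuousOn (uncurry fun t x => antider (f t) x) (Ici (0:ℝ) ×ˢ univ) := by
  have hP := continuousOn_parametric_primitive hf
  have hm := (continuousOn_parametric_integral hP (2 * π)).const_smul (1 / (2 * π))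
  exact hP.sub (hm.comp continuousOn_fst fun p hp => hp.1)

open Set Function in
/-- If `∂ₜ f = -a ∂ₓ g`, then `∂ₜ ∂ₓ⁻¹ f = -a (g - g_avg)`. -/
theorem hasDerivAt_antider_param {f g gx : ℝ → ℝ → ℝ} {a : ℝ}
    (hf : ContinuousOn (uncurry f) (Ici (0:ℝ) ×ˢ univ))
    (hg : ContinuousOn (uncurry g) (Ici (0:ℝ) ×ˢ univ))
    (hgx : ContinuousOn (uncurry gx) (Ioi (0:ℝ) ×ˢ univ))
    (hg_x : ∀ t, 0 < t → ∀ x, HasDerivAt (g t) (gx t x) x)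
    (hf_t : ∀ t, 0 < t → ∀ x, HasDerivAt (fun s => f s x) (-a * gx t x) t)
    {t : ℝ} (ht : 0 < t) (x : ℝ) :
    HasDerivAt (fun s => antider (f s) x) (-a * (g t x - havg (g t))) t := by
  have hP := continuousOn_parametric_primitive hf
  have hP_t : ∀ t, 0 < t → ∀ x, HasDerivAt (fun s => ∫ y in (0:ℝ)..x, f s y)
      (-a * (g t x - g t 0)) t := fun t ht x => by
    have h := hasDerivAt_parametric_integral hf (φ' := fun t x => -a * gx t x)
      (hgx.const_smul (-a)) hf_t ht 0 x
    have hint : ∫ y in (0:ℝ)..x, gx t y = g t x - g t 0 :=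
      intervalIntegral.integral_eq_sub_of_hasDerivAt (fun y _ => hg_x t ht y)
        ((continuous_section hgx ht).intervalIntegrable _ _)
    rw [← hint, ← intervalIntegral.integral_const_mul]
    exact h
  have hg' := hg.mono (prod_mono_left (t := (univ : Set ℝ)) (Ioi_subset_Ici_self (a := (0:ℝ))))
  have hg0 : ContinuousOn (fun p : ℝ × ℝ => g p.1 0) (Ioi (0:ℝ) ×ˢ univ) :=
    hg'.comp (f := fun p : ℝ × ℝ => (p.1, (0:ℝ))) (by fun_prop) fun p hp => ⟨hp.1, mem_univ _⟩
  have hm := (hasDerivAt_parametric_integral hP (φ' := fun t x => -a * (g t x - g t 0))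
    ((hg'.sub hg0).const_smul (-a)) hP_t ht 0 (2 * π)).const_mul (1 / (2 * π))
  have hgc := continuous_section hg (mem_Ici.2 ht.le)
  refine ((hP_t t ht x).sub hm).congr_deriv ?_
  rw [intervalIntegral.integral_const_mul,
    intervalIntegral.integral_sub (hgc.intervalIntegrable _ _) intervalIntegrable_const,
    intervalIntegral.integral_const, havg, smul_eq_mul]
  have := Real.pi_pos
  field_simp
  ring

open Set Function in
/-- Exponential decay of the entropy for a perturbation `(f, g, h)` of mean zero. -/
theorem entropy3_le_mul_exp {f g h fx gx hx : ℝ → ℝ → ℝ} {σ : ℝ → ℝ} {α m M : ℝ}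
    (hσc : Continuous σ) (hσm : ∀ x, m ≤ σ x) (hσM : ∀ x, σ x ≤ M)
    (hα : 0 ≤ α) (hα2 : 2 * α ≤ m) (hαM : α * (9 * M ^ 2 + 1) ≤ 3 * m)
    (hf : ContinuousOn (uncurry f) (Ici (0:ℝ) ×ˢ univ))
    (hg : ContinuousOn (uncurry g) (Ici (0:ℝ) ×ˢ univ))
    (hh : ContinuousOn (uncurry h) (Ici (0:ℝ) ×ˢ univ))
    (hfx : ContinuousOn (uncurry fx) (Ioi (0:ℝ) ×ˢ univ))
    (hgx : ContinuousOn (uncurry gx) (Ioi (0:ℝ) ×ˢ univ))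
    (hhx : ContinuousOn (uncurry hx) (Ioi (0:ℝ) ×ˢ univ))
    (hf_x : ∀ t, 0 < t → ∀ x, HasDerivAt (f t) (fx t x) x)
    (hg_x : ∀ t, 0 < t → ∀ x, HasDerivAt (g t) (gx t x) x)
    (hh_x : ∀ t, 0 < t → ∀ x, HasDerivAt (h t) (hx t x) x)
    (hf_t : ∀ t, 0 < t → ∀ x, HasDerivAt (fun s => f s x) (-√(2 / 3) * gx t x) t)
    (hg_t : ∀ t, 0 < t → ∀ x, HasDerivAt (fun s => g s x)
      (-√(2 / 3) * fx t x - 1 / √3 * hx t x - σ x * g t x) t)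
    (hh_t : ∀ t, 0 < t → ∀ x, HasDerivAt (fun s => h s x)
      (-(1 / √3) * gx t x - σ x * h t x) t)
    (hfp : ∀ t, f t (2 * π) = f t 0) (hgp : ∀ t, g t (2 * π) = g t 0)
    (hhp : ∀ t, h t (2 * π) = h t 0) (hmean : ∫ x in (0:ℝ)..(2 * π), f 0 x = 0)
    {t : ℝ} (ht : 0 ≤ t) :
    entropy3 (√6 * α) (f t) (g t) (h t) ≤
      entropy3 (√6 * α) (f 0) (g 0) (h 0) * Real.exp (-α * t) := by
  have hab : √6 * √(2 / 3) = 2 := by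
    rw [← Real.sqrt_mul (by norm_num), show (6 * (2 / 3) : ℝ) = 2 ^ 2 by norm_num]
    exact Real.sqrt_sq (by norm_num)
  have hbb : √6 * (1 / √3) = √2 := by
    rw [mul_one_div, ← Real.sqrt_div (by norm_num)]
    norm_num
  set a := √(2 / 3)
  set b := 1 / √3
  set θ := √6 * α
  have hπ : (0:ℝ) < 2 * π := Real.two_pi_pos
  have hsub : Ioi (0:ℝ) ×ˢ (univ : Set ℝ) ⊆ Ici (0:ℝ) ×ˢ univ :=
    prod_mono_left Ioi_subset_Ici_self
  have hmeant : ∀ t, 0 ≤ t → ∫ x in (0:ℝ)..(2 * π), f t x = 0 := fun t ht => by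
    refine (parametric_integral_eq hf (φ' := fun t x => -a * gx t x)
      (hgx.const_smul (-a)) hf_t (fun s hs => ?_) ht).trans hmean
    have : ∫ x in (0:ℝ)..(2 * π), gx s x = 0 := by
      rw [intervalIntegral.integral_eq_sub_of_hasDerivAt (fun y _ => hg_x s hs y)
        ((continuous_section hgx hs).intervalIntegrable _ _), hgp, sub_self]
    rw [intervalIntegral.integral_const_mul, this, mul_zero]
  let F : ℝ → ℝ → ℝ := fun t => antider (f t)
  have hF : ContinuousOn (uncurry F) (Ici (0:ℝ) ×ˢ univ) := continuousOn_antider hf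
  have hF_t : ∀ t, 0 < t → ∀ x, HasDerivAt (fun s => F s x) (-a * (g t x - havg (g t))) t :=
    fun t ht x => hasDerivAt_antider_param hf hg hgx hg_x hf_t ht x
  have hF_x : ∀ t, 0 ≤ t → ∀ x, HasDerivAt (F t) (f t x) x := fun t ht x =>
    hasDerivAt_antider (continuous_section hf ht) x
  have hFp : ∀ t, 0 ≤ t → F t (2 * π) = F t 0 := fun t ht => antider_two_pi (hmeant t ht)
  let φ : ℝ → ℝ → ℝ := fun t x => f t x ^ 2 + g t x ^ 2 + h t x ^ 2 - θ * (F t x * g t x)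
  let gt : ℝ → ℝ → ℝ := fun t x => -a * fx t x - b * hx t x - σ x * g t x
  let ht' : ℝ → ℝ → ℝ := fun t x => -b * gx t x - σ x * h t x
  let φ' : ℝ → ℝ → ℝ := fun t x => 2 * f t x * (-a * gx t x) + 2 * g t x * gt t x
    + 2 * h t x * ht' t x
    - θ * (-a * (g t x - havg (g t)) * g t x + F t x * gt t x)
  have hφ : ContinuousOn (uncurry φ) (Ici (0:ℝ) ×ˢ univ) :=
    (((hf.pow 2).add (hg.pow 2)).add (hh.pow 2)).sub (continuousOn_const.mul (hF.mul hg))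
  have hσ : ContinuousOn (fun p : ℝ × ℝ => σ p.2) (Ioi (0:ℝ) ×ˢ univ) := by fun_prop
  have hgt : ContinuousOn (uncurry gt) (Ioi (0:ℝ) ×ˢ univ) :=
    ((continuousOn_const.mul hfx).sub (continuousOn_const.mul hhx)).sub (hσ.mul (hg.mono hsub))
  have hht : ContinuousOn (uncurry ht') (Ioi (0:ℝ) ×ˢ univ) :=
    (continuousOn_const.mul hgx).sub (hσ.mul (hh.mono hsub))
  have hgavg : ContinuousOn (fun p : ℝ × ℝ => havg (g p.1)) (Ioi (0:ℝ) ×ˢ univ) :=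
    ((continuousOn_parametric_integral hg (2 * π)).const_smul (1 / (2 * π))).comp
      continuousOn_fst fun p hp => (hsub hp).1
  have hφ' : ContinuousOn (uncurry φ') (Ioi (0:ℝ) ×ˢ univ) := by
    refine ContinuousOn.sub (((?_ : ContinuousOn _ _).add ?_).add ?_) (continuousOn_const.mul
      (ContinuousOn.add ?_ ?_))
    · exact (continuousOn_const.mul (hf.mono hsub)).mul (continuousOn_const.mul hgx)
    · exact (continuousOn_const.mul (hg.mono hsub)).mul hgt
    · exact (continuousOn_const.mul (hh.mono hsub)).mul hht
    · exact (continuousOn_const.mul ((hg.mono hsub).sub hgavg)).mul (hg.mono hsub)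
    · exact (hF.mono hsub).mul hgt
  have hφ_t : ∀ t, 0 < t → ∀ x, HasDerivAt (fun s => φ s x) (φ' t x) t := fun t ht x => by
    have h := ((((hf_t t ht x).pow 2).add ((hg_t t ht x).pow 2)).add ((hh_t t ht x).pow 2)).sub
      (((hF_t t ht x).mul (hg_t t ht x)).const_mul θ)
    refine h.congr_deriv ?_
    simp only [φ', gt, ht']
    push_cast
    ring
  have hE : ∀ t, 0 ≤ t → entropy3 θ (f t) (g t) (h t)
      = 1 / (2 * π) * ∫ x in (0:ℝ)..(2 * π), φ t x := fun t ht => by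
    have cf := continuous_section hf (mem_Ici.2 ht)
    have cg := continuous_section hg (mem_Ici.2 ht)
    have ch := continuous_section hh (mem_Ici.2 ht)
    have cF : Continuous (antider (f t)) := continuous_section hF (mem_Ici.2 ht)
    simp only [φ, F]
    rw [intervalIntegral.integral_sub, intervalIntegral.integral_add, intervalIntegral.integral_add,
      intervalIntegral.integral_const_mul, entropy3, nsq, nsq, nsq]
    · ring
    all_goals exact Continuous.intervalIntegrable (by fun_prop) _ _
  have hdiss : ∀ t, 0 < t → ∫ x in (0:ℝ)..(2 * π), φ' t x
      ≤ -α * ∫ x in (0:ℝ)..(2 * π), φ t x := fun t ht => by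
    have cf := continuous_section hf (mem_Ici.2 ht.le)
    have cg := continuous_section hg (mem_Ici.2 ht.le)
    have ch := continuous_section hh (mem_Ici.2 ht.le)
    have cF := continuous_section hF (mem_Ici.2 ht.le)
    have cfx := continuous_section hfx (mem_Ioi.2 ht)
    have cgx := continuous_section hgx (mem_Ioi.2 ht)
    have chx := continuous_section hhx (mem_Ioi.2 ht)
    have cφ := continuous_section hφ (mem_Ici.2 ht.le)
    have cφ' := continuous_section hφ' (mem_Ioi.2 ht)
    let D : ℝ → ℝ := fun x => -2 * a * (fx t x * g t x + f t x * gx t x)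
      - 2 * b * (gx t x * h t x + g t x * hx t x)
      + θ * (f t x * (a * f t x + b * h t x) + F t x * (a * fx t x + b * hx t x))
    have hDc : Continuous D := by fun_prop
    have hD : ∫ x in (0:ℝ)..(2 * π), D x = 0 := by
      have hder : ∀ x ∈ uIcc 0 (2 * π), HasDerivAt (fun x => -2 * a * (f t x * g t x)
          - 2 * b * (g t x * h t x) + θ * (F t x * (a * f t x + b * h t x))) (D x) x := fun x _ =>
        ((((hf_x t ht x).mul (hg_x t ht x)).const_mul (-2 * a)).sub
          (((hg_x t ht x).mul (hh_x t ht x)).const_mul (2 * b))).add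
          (((hF_x t ht.le x).mul
            (((hf_x t ht x).const_mul a).add ((hh_x t ht x).const_mul b))).const_mul θ)
      rw [intervalIntegral.integral_eq_sub_of_hasDerivAt hder (hDc.intervalIntegrable _ _),
        hfp, hgp, hhp, hFp t ht.le, sub_self]
    have hpt : ∀ x, φ' t x + α * φ t x
        ≤ D x + α * (5 / 6) * (F t x ^ 2 - f t x ^ 2) - 2 * α * havg (g t) * g t x := fun x => by
      have hk := entropy_density_le (F := F t x) (f := f t x) (g := g t x) (h := h t x)
        hα (hσm x) (hσM x) hα2 hαM
      have e1 : θ * a = 2 * α := by rw [← hab]; ring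
      have e2 : θ * b = √2 * α := by rw [← hbb]; ring
      have key : φ' t x + α * φ t x = D x - 2 * α * havg (g t) * g t x
          + (-2 * σ x * (g t x ^ 2 + h t x ^ 2) + 2 * α * g t x ^ 2
            + √6 * α * σ x * F t x * g t x - 2 * α * f t x ^ 2 - √2 * α * f t x * h t x
            + α * (f t x ^ 2 + g t x ^ 2 + h t x ^ 2 - √6 * α * (F t x * g t x))) := by
        simp only [φ', φ, gt, ht', D]
        linear_combination (g t x ^ 2 - havg (g t) * g t x - f t x ^ 2) * e1
          - f t x * h t x * e2
      linarith
    have hW := integral_sq_le_integral_deriv_sq cf (hF_x t ht.le) (hFp t ht.le)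
      (integral_antider cf)
    have hmono := intervalIntegral.integral_mono_on (a := 0) (b := 2 * π) (μ := volume) hπ.le
      (Continuous.intervalIntegrable (by fun_prop) _ _)
      (Continuous.intervalIntegrable (by fun_prop) _ _) fun x _ => hpt x
    have iF : IntervalIntegrable (fun x => F t x ^ 2) volume 0 (2 * π) :=
      (cF.pow 2).intervalIntegrable _ _
    have if' : IntervalIntegrable (fun x => f t x ^ 2) volume 0 (2 * π) :=
      (cf.pow 2).intervalIntegrable _ _
    have ig := cg.intervalIntegrable (μ := volume) 0 (2 * π)
    rw [intervalIntegral.integral_add (cφ'.intervalIntegrable _ _)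
        ((cφ.intervalIntegrable _ _).const_mul α),
      intervalIntegral.integral_sub ((hDc.intervalIntegrable _ _).add
        ((iF.sub if').const_mul _)) (ig.const_mul _),
      intervalIntegral.integral_add (hDc.intervalIntegrable _ _) ((iF.sub if').const_mul _),
      intervalIntegral.integral_const_mul, intervalIntegral.integral_const_mul,
      intervalIntegral.integral_const_mul, intervalIntegral.integral_sub iF if', hD] at hmono
    have hgg : 0 ≤ havg (g t) * ∫ x in (0:ℝ)..(2 * π), g t x := by
      rw [havg, mul_assoc]
      exact mul_nonneg (by positivity) (mul_self_nonneg _)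
    nlinarith [mul_nonneg hα hgg, mul_le_mul_of_nonneg_left hW hα]
  have hfin := le_mul_exp_of_hasDerivAt_le (continuousOn_parametric_integral hφ (2 * π))
    (fun s hs => hasDerivAt_parametric_integral hφ hφ' hφ_t hs 0 (2 * π)) hdiss ht
  rw [hE t ht, hE 0 le_rfl, mul_assoc]
  exact mul_le_mul_of_nonneg_left hfin (by positivity)

/-- Corollary 6.3 (second part): explicit decay rate α = min(σ_min/2, 3σ_min/(9σ_max²+1))
with θ = √6·α for the 3-velocity Goldstein–Taylor model. -/
theorem gt3_entropy_decay_explicit_rate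
    (σ : ℝ → ℝ) (hσc : Continuous σ) (hσp : Function.Periodic σ (2 * π))
    (hmin : 0 < sInf (Set.range σ))
    (u₁ u₂ u₃ : ℝ → ℝ → ℝ) (u₁₀ u₂₀ u₃₀ : ℝ → ℝ)
    (h1C : ContDiffOn ℝ 1 (Function.uncurry u₁) (Set.Ici (0:ℝ) ×ˢ Set.univ))
    (h2C : ContDiffOn ℝ 1 (Function.uncurry u₂) (Set.Ici (0:ℝ) ×ˢ Set.univ))
    (h3C : ContDiffOn ℝ 1 (Function.uncurry u₃) (Set.Ici (0:ℝ) ×ˢ Set.univ))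
    (h1p : ∀ t, Function.Periodic (u₁ t) (2 * π))
    (h2p : ∀ t, Function.Periodic (u₂ t) (2 * π))
    (h3p : ∀ t, Function.Periodic (u₃ t) (2 * π))
    (hpde1 : ∀ t, 0 < t → ∀ x,
      deriv (fun s => u₁ s x) t + Real.sqrt (2 / 3) * deriv (fun y => u₂ t y) x = 0)
    (hpde2 : ∀ t, 0 < t → ∀ x,
      deriv (fun s => u₂ s x) t + Real.sqrt (2 / 3) * deriv (fun y => u₁ t y) x +
        (1 / Real.sqrt 3) * deriv (fun y => u₃ t y) x = -σ x * u₂ t x)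
    (hpde3 : ∀ t, 0 < t → ∀ x,
      deriv (fun s => u₃ s x) t + (1 / Real.sqrt 3) * deriv (fun y => u₂ t y) x
        = -σ x * u₃ t x)
    (h10 : ∀ x, u₁ 0 x = u₁₀ x) (h20 : ∀ x, u₂ 0 x = u₂₀ x) (h30 : ∀ x, u₃ 0 x = u₃₀ x) :
    ∀ t, 0 ≤ t →
      entropy3 (Real.sqrt 6 *
            min (sInf (Set.range σ) / 2)
              (3 * sInf (Set.range σ) / (9 * (sSup (Set.range σ)) ^ 2 + 1)))
          (fun x => u₁ t x - havg u₁₀) (u₂ t) (u₃ t) ≤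
        entropy3 (Real.sqrt 6 *
              min (sInf (Set.range σ) / 2)
                (3 * sInf (Set.range σ) / (9 * (sSup (Set.range σ)) ^ 2 + 1)))
            (fun x => u₁₀ x - havg u₁₀) u₂₀ u₃₀ *
          Real.exp (-(min (sInf (Set.range σ) / 2)
              (3 * sInf (Set.range σ) / (9 * (sSup (Set.range σ)) ^ 2 + 1))) * t) := by
  obtain rfl : u₁₀ = u₁ 0 := funext fun x => (h10 x).symm
  obtain rfl : u₂₀ = u₂ 0 := funext fun x => (h20 x).symm
  obtain rfl : u₃₀ = u₃ 0 := funext fun x => (h30 x).symm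
  intro t ht
  have hbdd := hσp.isBounded_of_continuous Real.two_pi_pos.ne' hσc
  have hσm : ∀ x, sInf (Set.range σ) ≤ σ x := fun x => csInf_le hbdd.bddBelow ⟨x, rfl⟩
  have hσM : ∀ x, σ x ≤ sSup (Set.range σ) := fun x => le_csSup hbdd.bddAbove ⟨x, rfl⟩
  set m := sInf (Set.range σ)
  set M := sSup (Set.range σ)
  obtain ⟨v₁, hv₁, hd₁⟩ := exists_partial_derivs h1C
  obtain ⟨v₂, hv₂, hd₂⟩ := exists_partial_derivs h2C
  obtain ⟨v₃, hv₃, hd₃⟩ := exists_partial_derivs h3C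
  have hperiod : ∀ u : ℝ → ℝ, Function.Periodic u (2 * π) → u (2 * π) = u 0 := fun u hu => by
    simpa using hu 0
  refine entropy3_le_mul_exp (f := fun t x => u₁ t x - havg (u₁ 0)) (g := u₂) (h := u₃)
    (m := m) (M := M) (fx := v₁) (gx := v₂) (hx := v₃) hσc hσm hσM
    (le_min (by positivity) (by positivity)) ?_ ?_
    (h1C.continuousOn.sub continuousOn_const) h2C.continuousOn h3C.continuousOn hv₁ hv₂ hv₃
    (fun s hs x => ((hd₁ s hs x).2).sub_const _) (fun s hs x => (hd₂ s hs x).2)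
    (fun s hs x => (hd₃ s hs x).2) ?_ ?_ ?_ ?_ (fun s => hperiod _ (h2p s))
    (fun s => hperiod _ (h3p s)) ?_ ht
  · linarith [min_le_left (m / 2) (3 * m / (9 * M ^ 2 + 1))]
  · rw [← le_div_iff₀ (by positivity)]
    exact min_le_right _ _
  · intro s hs x
    have h := hpde1 s hs x
    rw [(hd₂ s hs x).2.deriv] at h
    refine ((hd₁ s hs x).1.hasDerivAt.sub_const (havg (u₁ 0))).congr_deriv ?_
    linarith
  · intro s hs x
    have h := hpde2 s hs x
    rw [(hd₁ s hs x).2.deriv, (hd₃ s hs x).2.deriv] at h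
    refine (hd₂ s hs x).1.hasDerivAt.congr_deriv ?_
    linarith
  · intro s hs x
    have h := hpde3 s hs x
    rw [(hd₂ s hs x).2.deriv] at h
    refine (hd₃ s hs x).1.hasDerivAt.congr_deriv ?_
    linarith
  · exact fun s => congrArg (· - havg (u₁ 0)) (hperiod _ (h1p s))
  · have hc := continuous_section h1C.continuousOn (Set.mem_Ici.2 (le_refl (0:ℝ)))
    have hπ := Real.pi_pos
    rw [intervalIntegral.integral_sub (hc.intervalIntegrable _ _) intervalIntegrable_const,
      intervalIntegral.integral_const, havg, smul_eq_mul]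
    field_simp
    ring
end
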